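/- arXiv:2303.07784 — 2 statements merged into one kernel-verified Lean document; each statement's English description precedes it below -/
import Mathlib

section
/- Let X be a closed connected topological n-manifold. Then there exists an integer R such that for every integer r ≥ R there is no free continuous action of the group (ℤ/rℤ)^{n+1} on X. (Equivalently, the discrete degree of free symmetry of X is at most n.) -/
/-- The group of self-homeomorphisms of a topological space, with `(f * g) x = f (g x)`. -/
instance homeoGroup (X : Type*) [TopologicalSpace X] : Group (X ≃ₜ X) where
  mul f g := g.trans f
  one := Homeomorph.refl X
  inv := Homeomorph.symm
  mul_assoc _ _ _ := Homeomorph.ext fun _ => rfl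
  one_mul _ := Homeomorph.ext fun _ => rfl
  mul_one _ := Homeomorph.ext fun _ => rfl
  inv_mul_cancel := Homeomorph.self_trans_symm

/-! ## Ordered tuple chains -/

/-- Augmented ordered chains: formal combinations of lists (a list of length `k` is a simplex of
dimension `k - 1`). -/
abbrev Ch (X : Type*) := List X →₀ ℤ

namespace Ch

noncomputable section

variable {X Y : Type*}

/-- basis element -/
abbrev b (l : List X) : Ch X := Finsupp.single l 1

/-- cone operator -/
def cone (x : X) : Ch X →ₗ[ℤ] Ch X := Finsupp.lmapDomain ℤ ℤ (List.cons x)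

/-- linear extension -/
def ext {M : Type*} [AddCommGroup M] (f : List X → M) : Ch X →ₗ[ℤ] M :=
  Finsupp.linearCombination ℤ f

@[simp] lemma cone_b (x : X) (l : List X) : cone x (b l) = b (x :: l) := by
  simp [cone, b]

@[simp] lemma ext_b {M : Type*} [AddCommGroup M] (f : List X → M) (l : List X) :
    ext f (b l) = f l := by
  simp [ext, b]

/-- boundary of a list -/
def bdL : List X → Ch X
  | [] => 0
  | x :: l => b l - cone x (bdL l)

/-- boundary -/
def bd : Ch X →ₗ[ℤ] Ch X := ext bdL

@[simp] lemma bd_nil : bd (b ([] : List X)) = 0 := by simp [bd, bdL]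

@[simp] lemma bd_cons (x : X) (l : List X) : bd (b (x :: l)) = b l - cone x (bd (b l)) := by
  simp [bd, bdL]

lemma hom_ext {M : Type*} [AddCommGroup M] {f g : Ch X →ₗ[ℤ] M} (h : ∀ l, f (b l) = g (b l)) :
    f = g := by
  apply Finsupp.lhom_ext'
  intro l
  apply LinearMap.ext_ring
  exact h l

lemma hom_ext' {M : Type*} [AddCommGroup M] {f g : Ch X →ₗ[ℤ] M} (h : ∀ l, f (b l) = g (b l))
    (c : Ch X) : f c = g c := by rw [hom_ext h]

lemma bd_cone (x : X) (c : Ch X) : bd (cone x c) = c - cone x (bd c) := by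
  have := hom_ext' (f := bd ∘ₗ cone x) (g := LinearMap.id - cone x ∘ₗ bd)
    (by intro l; simp) c
  simpa using this

lemma bd_bd (c : Ch X) : bd (bd c) = 0 := by
  have := hom_ext' (f := bd ∘ₗ bd) (g := (0 : Ch X →ₗ[ℤ] Ch X)) (by
    intro l
    induction l with
    | nil => simp
    | cons x l ih =>
      simp only [LinearMap.comp_apply, LinearMap.zero_apply] at ih
      simp [bd_cone, ih]) c
  simpa using this

/-- map induced by a function -/
def mp (f : X → Y) : Ch X →ₗ[ℤ] Ch Y := Finsupp.lmapDomain ℤ ℤ (List.map f)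

@[simp] lemma mp_b (f : X → Y) (l : List X) : mp f (b l) = b (l.map f) := by
  simp [mp, b]

lemma mp_cone (f : X → Y) (x : X) (c : Ch X) : mp f (cone x c) = cone (f x) (mp f c) := by
  have := hom_ext' (f := mp f ∘ₗ cone x) (g := cone (f x) ∘ₗ mp f) (by intro l; simp) c
  simpa using this

lemma mp_bd (f : X → Y) (c : Ch X) : mp f (bd c) = bd (mp f c) := by
  have := hom_ext' (f := mp f ∘ₗ bd) (g := bd ∘ₗ mp f) (by
    intro l
    induction l with
    | nil => simp
    | cons x l ih =>
      simp only [LinearMap.comp_apply, mp_b] at ih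
      simp [mp_cone, ih]) c
  simpa using this

lemma mp_mp {Z : Type*} (g : Y → Z) (f : X → Y) (c : Ch X) :
    mp g (mp f c) = mp (fun x => g (f x)) c := by
  have := hom_ext' (f := mp g ∘ₗ mp f) (g := mp (fun x => g (f x))) (by
    intro l; simp [Function.comp_def]) c
  simpa using this

lemma mp_id (f : X → X) (hf : ∀ x, f x = x) (c : Ch X) : mp f c = c := by
  have hf' : f = id := funext hf
  have := hom_ext' (f := mp f) (g := LinearMap.id) (by
    intro l; simp [hf']) c
  simpa using this

/-- prism of a list -/
def prL (f g : X → Y) : List X → Ch Y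
  | [] => 0
  | x :: l => b (f x :: g x :: l.map g) - cone (f x) (prL f g l)

/-- prism operator -/
def pr (f g : X → Y) : Ch X →ₗ[ℤ] Ch Y := ext (prL f g)

@[simp] lemma pr_nil (f g : X → Y) : pr f g (b []) = 0 := by simp [pr, prL]

@[simp] lemma pr_cons (f g : X → Y) (x : X) (l : List X) :
    pr f g (b (x :: l)) = b (f x :: g x :: l.map g) - cone (f x) (pr f g (b l)) := by
  simp [pr, prL]

lemma pr_cone (f g : X → Y) (x : X) (c : Ch X) :
    pr f g (cone x c) = cone (f x) (cone (g x) (mp g c)) - cone (f x) (pr f g c) := by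
  have := hom_ext' (f := pr f g ∘ₗ cone x)
    (g := cone (f x) ∘ₗ cone (g x) ∘ₗ mp g - cone (f x) ∘ₗ pr f g) (by intro l; simp) c
  simpa using this

lemma bd_pr (f g : X → Y) (c : Ch X) :
    bd (pr f g c) = mp g c - mp f c - pr f g (bd c) := by
  have := hom_ext' (f := bd ∘ₗ pr f g) (g := mp g - mp f - pr f g ∘ₗ bd) (by
    intro l
    induction l with
    | nil => simp
    | cons x l ih =>
      simp only [LinearMap.comp_apply, LinearMap.sub_apply, mp_b] at ih
      simp only [LinearMap.comp_apply, LinearMap.sub_apply, mp_b, pr_cons, map_sub, bd_cons,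
        bd_cone, ih, pr_cone, cone_b, List.map_cons]
      rw [← mp_b, ← mp_bd]
      abel) c
  simpa using this

/-- chains supported on a set of lists -/
abbrev sup (S : Set (List X)) : Submodule ℤ (Ch X) := Finsupp.supported ℤ ℤ S

lemma b_mem {S : Set (List X)} {l : List X} (h : l ∈ S) : b l ∈ sup S :=
  Finsupp.single_mem_supported ℤ 1 h

lemma sup_ind {M : Type*} [AddCommGroup M] {S : Set (List X)} {c : Ch X} (hc : c ∈ sup S)
    (f : Ch X →ₗ[ℤ] M) (p : Submodule ℤ M) (h : ∀ l ∈ S, f (b l) ∈ p) : f c ∈ p := by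
  unfold sup at hc
  rw [Finsupp.supported_eq_span_single] at hc
  have : Submodule.span ℤ ((fun i ↦ Finsupp.single i (1:ℤ)) '' S) ≤ p.comap f := by
    rw [Submodule.span_le]
    rintro _ ⟨l, hl, rfl⟩
    exact h l hl
  exact this hc

lemma sup_eq {M : Type*} [AddCommGroup M] {S : Set (List X)} {c : Ch X} (hc : c ∈ sup S)
    (f g : Ch X →ₗ[ℤ] M) (h : ∀ l ∈ S, f (b l) = g (b l)) : f c = g c := by
  have := sup_ind hc (f - g) ⊥ (by intro l hl; simp [h l hl])
  simpa [sub_eq_zero] using this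

/-- lists of length `k` with entries in `A` -/
def V (A : Set X) (k : ℕ) : Set (List X) := {l | l.length = k ∧ ∀ x ∈ l, x ∈ A}

lemma V_mono {A B : Set X} (h : A ⊆ B) (k : ℕ) : V A k ⊆ V B k :=
  fun _ hl => ⟨hl.1, fun x hx => h (hl.2 x hx)⟩

lemma cone_V {A : Set X} {k : ℕ} {x : X} (hx : x ∈ A) {c : Ch X} (hc : c ∈ sup (V A k)) :
    cone x c ∈ sup (V A (k+1)) := by
  refine sup_ind hc _ _ fun l hl => ?_
  rw [cone_b]
  refine b_mem ⟨by simp [hl.1], ?_⟩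
  intro y hy
  rcases List.mem_cons.1 hy with rfl | hy
  · exact hx
  · exact hl.2 y hy

lemma bd_b_V (l : List X) : bd (b l) ∈ sup (V {x | x ∈ l} (l.length - 1)) := by
  induction l with
  | nil => simp
  | cons x l ih =>
    rw [bd_cons]
    refine Submodule.sub_mem _ (b_mem ⟨by simp, fun y hy => by simp [hy]⟩) ?_
    rcases l with _ | ⟨y, l⟩
    · simp
    · have := cone_V (A := {z | z ∈ x :: y :: l}) (x := x) (by simp)
        (Finsupp.supported_mono (V_mono (fun z hz => by
          simp only [Set.mem_ofPred_eq] at hz ⊢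
          exact List.mem_cons_of_mem _ hz) _) ih)
      simpa using this

lemma pr_b_V (f g : X → Y) (l : List X) :
    pr f g (b l) ∈ sup (V {y | ∃ x ∈ l, y = f x ∨ y = g x} (l.length + 1)) := by
  induction l with
  | nil => simp
  | cons x l ih =>
    rw [pr_cons]
    refine Submodule.sub_mem _ (b_mem ⟨by simp, ?_⟩) ?_
    · intro y hy
      simp only [List.mem_cons, List.mem_map] at hy
      rcases hy with rfl | rfl | ⟨z, hz, rfl⟩
      · exact ⟨x, by simp, Or.inl rfl⟩
      · exact ⟨x, by simp, Or.inr rfl⟩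
      · exact ⟨z, by simp [hz], Or.inr rfl⟩
    · refine cone_V (A := {y | ∃ x' ∈ x :: l, y = f x' ∨ y = g x'})
        ⟨x, by simp, Or.inl rfl⟩ (Finsupp.supported_mono (V_mono ?_ _) ih)
      rintro y ⟨z, hz, h⟩
      exact ⟨z, by simp [hz], h⟩

/-- lists of length `k` all of whose entries are pairwise `E`-related. -/
def SL (E : X → X → Prop) (k : ℕ) : Set (List X) :=
  {l | l.length = k ∧ ∀ x ∈ l, ∀ y ∈ l, E x y}

/-- `E`-small chains of length `k` -/
abbrev R (E : X → X → Prop) (k : ℕ) : Submodule ℤ (Ch X) := sup (SL E k)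

lemma R_mono {E F : X → X → Prop} (h : ∀ x y, E x y → F x y) (k : ℕ) : R E k ≤ R F k :=
  Finsupp.supported_mono fun _ hl => ⟨hl.1, fun x hx y hy => h _ _ (hl.2 x hx y hy)⟩

lemma V_sub_SL {E : X → X → Prop} {A : Set X} (h : ∀ x ∈ A, ∀ y ∈ A, E x y) (k : ℕ) :
    V A k ⊆ SL E k :=
  fun _ hl => ⟨hl.1, fun x hx y hy => h _ (hl.2 x hx) _ (hl.2 y hy)⟩

lemma bd_R {E : X → X → Prop} {k : ℕ} {c : Ch X} (hc : c ∈ R E (k + 1)) : bd c ∈ R E k := by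
  refine sup_ind hc _ _ fun l hl => ?_
  have := bd_b_V l
  rw [hl.1] at this
  exact Finsupp.supported_mono (V_sub_SL hl.2 k) this

lemma bd_R_zero {E : X → X → Prop} {c : Ch X} (hc : c ∈ R E 0) : bd c = 0 := by
  have := sup_ind hc bd ⊥ fun l hl => ?_
  · simpa using this
  · obtain ⟨h, _⟩ := hl
    rw [List.length_eq_zero_iff] at h
    subst h
    simp

lemma mp_R {E : X → X → Prop} {F : Y → Y → Prop} {f : X → Y} (h : ∀ x y, E x y → F (f x) (f y))
    {k : ℕ} {c : Ch X} (hc : c ∈ R E k) : mp f c ∈ R F k := by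
  refine sup_ind hc _ _ fun l hl => ?_
  rw [mp_b]
  refine b_mem ⟨by simp [hl.1], ?_⟩
  simp only [List.mem_map]
  rintro _ ⟨x, hx, rfl⟩ _ ⟨y, hy, rfl⟩
  exact h _ _ (hl.2 x hx y hy)

lemma pr_R {E : X → X → Prop} {F : Y → Y → Prop} {f g : X → Y}
    (h : ∀ x y, E x y → F (f x) (f y) ∧ F (f x) (g y) ∧ F (g x) (f y) ∧ F (g x) (g y))
    {k : ℕ} {c : Ch X} (hc : c ∈ R E k) : pr f g c ∈ R F (k + 1) := by
  refine sup_ind hc _ _ fun l hl => ?_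
  have := pr_b_V f g l
  rw [hl.1] at this
  refine Finsupp.supported_mono (V_sub_SL ?_ _) this
  rintro _ ⟨x, hx, h1⟩ _ ⟨y, hy, h2⟩
  have := h x y (hl.2 x hx y hy)
  rcases h1 with rfl | rfl <;> rcases h2 with rfl | rfl <;> tauto

end

end Ch

namespace Ch

noncomputable section

open Set Metric Topology

variable {X : Type*}

lemma exists_pos_le {ι : Type*} (t : Finset ι) (f : ι → ℝ) (hf : ∀ i, 0 < f i) :
    ∃ δ > 0, ∀ i ∈ t, δ ≤ f i := by
  classical
  induction t using Finset.induction_on with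
  | empty => exact ⟨1, one_pos, by simp⟩
  | insert a s _ ih =>
    obtain ⟨δ, hδ, h⟩ := ih
    refine ⟨min δ (f a), lt_min hδ (hf a), ?_⟩
    intro i hi
    rcases Finset.mem_insert.1 hi with rfl | hi
    · exact min_le_right _ _
    · exact (min_le_left _ _).trans (h i hi)

lemma fillK [MetricSpace X] {K : Set X} (hK : IsCompact K) (H : X × ℝ → X)
    (hH : ContinuousOn H (K ×ˢ Icc 0 1)) (hm : ∀ x ∈ K, ∀ t ∈ Icc (0:ℝ) 1, H (x, t) ∈ K)
    (h0 : ∀ x ∈ K, H (x, 0) = x) (p : X) (hp : p ∈ K) (h1 : ∀ x ∈ K, H (x, 1) = p)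
    (ε : ℝ) (hε : 0 < ε) :
    ∃ δ > 0, ∀ k, ∀ z ∈ R (fun a b => a ∈ K ∧ b ∈ K ∧ dist a b < δ) k, bd z = 0 →
      ∃ w ∈ R (fun a b => a ∈ K ∧ b ∈ K ∧ dist a b < ε) (k + 1), bd w = z := by
  have huc := (hK.prod (isCompact_Icc (a := (0:ℝ)) (b := 1))).uniformContinuousOn_of_continuous hH
  obtain ⟨δ, hδ, hu⟩ := Metric.uniformContinuousOn_iff.1 huc ε hε
  refine ⟨δ, hδ, ?_⟩
  intro k z hz hbz
  obtain ⟨N, hN⟩ := exists_nat_one_div_lt hδ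
  set f : ℕ → X → X := fun j x => H (x, (j:ℝ) / (N + 1)) with hf
  have hN0 : (0:ℝ) < N + 1 := by positivity
  have hmem : ∀ j : ℕ, j ≤ N + 1 → (j:ℝ) / (N + 1) ∈ Icc (0:ℝ) 1 := by
    intro j hj
    refine ⟨by positivity, ?_⟩
    rw [div_le_one hN0]
    exact_mod_cast hj
  have hzV : z ∈ sup (V K k) := by
    refine Finsupp.supported_mono ?_ hz
    intro l hl
    exact ⟨hl.1, fun x hx => (hl.2 x hx x hx).1⟩
  have hf0 : mp (f 0) z = z := by
    have := sup_eq hzV (mp (f 0)) LinearMap.id (by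
      intro l hl
      simp only [mp_b, LinearMap.id_apply]
      congr 1
      conv_rhs => rw [← List.map_id l]
      apply List.map_congr_left
      intro x hx
      simp [hf, h0 x (hl.2 x hx)])
    simpa using this
  have hfN : mp (f (N + 1)) z ∈ sup (V {p} k) := by
    refine sup_ind hzV _ _ fun l hl => ?_
    rw [mp_b]
    refine b_mem ⟨by simp [hl.1], ?_⟩
    simp only [List.mem_map]
    rintro _ ⟨x, hx, rfl⟩
    have : (((N + 1 : ℕ) : ℝ)) / (N + 1) = 1 := by
      push_cast; exact div_self hN0.ne'
    simp only [hf, this, h1 x (hl.2 x hx)]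
    rfl
  refine ⟨cone p (mp (f (N+1)) z) - ∑ j ∈ Finset.range (N + 1), pr (f j) (f (j+1)) z, ?_, ?_⟩
  · refine Submodule.sub_mem _ ?_ (Submodule.sum_mem _ ?_)
    · refine Finsupp.supported_mono (V_sub_SL ?_ _) (cone_V (A := {p}) rfl hfN)
      rintro x hx y hy
      rw [mem_singleton_iff] at hx hy
      subst hx; subst hy
      exact ⟨hp, hp, by simpa using hε⟩
    · intro j hj
      have hj' := Finset.mem_range.1 hj
      have hd : ∀ i i' : ℕ, (i = j ∨ i = j + 1) → (i' = j ∨ i' = j + 1) →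
          ∀ x y, (x ∈ K ∧ y ∈ K ∧ dist x y < δ) →
          f i x ∈ K ∧ f i' y ∈ K ∧ dist (f i x) (f i' y) < ε := by
        intro i i' hi hi' x y hxy
        have hi1 := hmem i (by omega)
        have hi2 := hmem i' (by omega)
        refine ⟨hm x hxy.1 _ hi1, hm y hxy.2.1 _ hi2, ?_⟩
        refine hu (x, _) ⟨hxy.1, hi1⟩ (y, _) ⟨hxy.2.1, hi2⟩ ?_
        rw [Prod.dist_eq, max_lt_iff]
        refine ⟨hxy.2.2, ?_⟩
        refine lt_of_le_of_lt ?_ hN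
        simp only [Real.dist_eq]
        rw [← sub_div, abs_div, abs_of_pos hN0]
        gcongr
        rw [abs_le]
        rcases hi with rfl | rfl <;> rcases hi' with rfl | rfl <;> push_cast <;>
          constructor <;> linarith
      refine pr_R ?_ hz
      intro x y hxy
      exact ⟨hd _ _ (Or.inl rfl) (Or.inl rfl) x y hxy, hd _ _ (Or.inl rfl) (Or.inr rfl) x y hxy,
        hd _ _ (Or.inr rfl) (Or.inl rfl) x y hxy, hd _ _ (Or.inr rfl) (Or.inr rfl) x y hxy⟩
  · rw [map_sub, map_sum, bd_cone, ← mp_bd, hbz]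
    simp only [bd_pr, hbz, map_zero, sub_zero]
    rw [Finset.sum_range_sub (fun j => mp (f j) z), hf0]
    abel

/-- local contractibility in the form we use -/
def LCon (X : Type*) [MetricSpace X] : Prop :=
  ∀ p : X, ∀ ε > 0, ∃ K ∈ 𝓝 p, IsCompact K ∧ K ⊆ ball p ε ∧ ∃ H : X × ℝ → X,
    ContinuousOn H (K ×ˢ Icc 0 1) ∧ (∀ x ∈ K, ∀ t ∈ Icc (0:ℝ) 1, H (x, t) ∈ K) ∧
    (∀ x ∈ K, H (x, 0) = x) ∧ ∃ q ∈ K, ∀ x ∈ K, H (x, 1) = q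

lemma fillLoc [MetricSpace X] [CompactSpace X] (hX : LCon X) (ε : ℝ) (hε : 0 < ε) :
    ∃ δ > 0, ∀ ε' > 0, ∃ δ' > 0, ∀ (x : X) (k : ℕ),
      ∀ z ∈ R (fun a b => dist a x < δ ∧ dist b x < δ ∧ dist a b < δ') k, bd z = 0 →
      ∃ w ∈ R (fun a b => dist a x < ε ∧ dist b x < ε ∧ dist a b < ε') (k + 1), bd w = z := by
  choose K hKn hKc hKb H hH hm h0 q hq h1 using fun p => hX p (ε / 2) (half_pos hε)
  obtain ⟨t, -, ht⟩ := isCompact_univ.elim_nhds_subcover K (fun x _ => hKn x)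
  obtain ⟨t, ht⟩ : ∃ t : Finset X, (univ : Set X) ⊆ ⋃ x ∈ t, interior (K x) := by
    obtain ⟨t, -, ht⟩ := isCompact_univ.elim_nhds_subcover (fun x => interior (K x))
      (fun x _ => interior_mem_nhds.2 (hKn x))
    exact ⟨t, ht⟩
  obtain ⟨δ, hδ, hL⟩ := lebesgue_number_lemma_of_metric (s := (univ : Set X))
    (c := fun p : t => interior (K p)) isCompact_univ (fun _ => isOpen_interior) (by
      intro x hx
      have := ht hx
      simp only [mem_iUnion] at this ⊢
      obtain ⟨p, hp, h⟩ := this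
      exact ⟨⟨p, hp⟩, h⟩)
  refine ⟨δ, hδ, ?_⟩
  intro ε' hε'
  choose d hd hfill using fun p =>
    fillK (hKc p) (H p) (hH p) (hm p) (h0 p) (q p) (hq p) (h1 p) ε' hε'
  obtain ⟨δ', hδ', hle⟩ := exists_pos_le t d hd
  refine ⟨δ', hδ', ?_⟩
  intro x k z hz hbz
  obtain ⟨⟨p, hp⟩, hxp⟩ := hL x (mem_univ x)
  have hsub : ball x δ ⊆ K p := hxp.trans interior_subset
  obtain ⟨w, hw, hbw⟩ := hfill p k z (R_mono (by
    rintro a b ⟨ha, hb, hab⟩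
    exact ⟨hsub ha, hsub hb, hab.trans_le (hle p hp)⟩) k hz) hbz
  refine ⟨w, R_mono ?_ _ hw, hbw⟩
  rintro a b ⟨ha, hb, hab⟩
  have hx := hKb p (hsub (mem_ball_self hδ))
  have ha' := hKb p ha
  have hb' := hKb p hb
  rw [mem_ball] at hx ha' hb'
  refine ⟨?_, ?_, hab⟩
  · have := dist_triangle_right a x p; linarith
  · have := dist_triangle_right b x p; linarith

/-- `ε`-small relation -/
def dl [MetricSpace X] (ε : ℝ) : X → X → Prop := fun a b => dist a b < ε

lemma exists_S [MetricSpace X] [CompactSpace X] (hX : LCon X) (m : ℕ) : ∀ ε > 0, ∃ δ > 0,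
    ∀ ε' > 0, ∃ ε'' > 0, ∃ S : Ch X →ₗ[ℤ] Ch X, ∀ k ≤ m, ∀ l ∈ SL (dl δ) k,
      bd (S (b l)) = S (bd (b l)) ∧
      S (b l) ∈ R (fun u v => (∃ x ∈ l, dist u x < ε) ∧ (∃ x ∈ l, dist v x < ε) ∧ dist u v < ε') k ∧
      (l ∈ SL (dl ε'') k → S (b l) = b l) := by
  classical
  induction m with
  | zero =>
    intro ε hε
    refine ⟨1, one_pos, fun ε' hε' => ⟨1, one_pos, LinearMap.id, ?_⟩⟩
    intro k hk l hl
    obtain rfl : k = 0 := by omega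
    have h : l = [] := List.length_eq_zero_iff.1 hl.1
    subst h
    refine ⟨by simp, b_mem ⟨rfl, by simp⟩, by simp⟩
  | succ m ih =>
    intro ε hε
    obtain ⟨δ₁, hδ₁, hF⟩ := fillLoc hX ε hε
    obtain ⟨δm, hδm, hS⟩ := ih (δ₁ / 2) (half_pos hδ₁)
    obtain ⟨δn, hδn, hS'⟩ := ih ε hε
    obtain ⟨δm, hδm, hS⟩ := ih (min (δ₁ / 2) ε) (lt_min (half_pos hδ₁) hε)
    refine ⟨min δm (δ₁ / 2), lt_min hδm (half_pos hδ₁), ?_⟩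
    intro ε' hε'
    obtain ⟨δ', hδ', hF⟩ := hF ε' hε'
    obtain ⟨e, he, S, hS⟩ := hS (min δ' ε') (lt_min hδ' hε')
    have hcyc : ∀ l ∈ SL (dl (min δm (δ₁ / 2))) (m + 1), bd (S (bd (b l))) = 0 := by
      intro l hl
      have h1 : bd (b l) ∈ R (dl δm) m :=
        R_mono (fun x y h => lt_of_lt_of_le h (min_le_left _ _)) m (bd_R (b_mem hl))
      have := sup_eq h1 (bd ∘ₗ S) (S ∘ₗ bd) (by
        intro l' hl'
        exact (hS m le_rfl l' hl').1)
      simp only [LinearMap.comp_apply, bd_bd, map_zero] at this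
      exact this
    have hbdV : ∀ l : List X, l.length = m + 1 →
        bd (b l) ∈ sup (V {x | x ∈ l} m) := by
      intro l hl
      have := bd_b_V l
      rwa [hl] at this
    have hex : ∀ l : List X, ∃ w : Ch X, l ∈ SL (dl (min δm (δ₁ / 2))) (m + 1) →
        bd w = S (bd (b l)) ∧ w ∈ R (fun u v => (∃ x ∈ l, dist u x < ε) ∧
          (∃ x ∈ l, dist v x < ε) ∧ dist u v < ε') (m + 1) ∧
        (l ∈ SL (dl (min e ε')) (m + 1) → w = b l) := by
      intro l
      by_cases hl : l ∈ SL (dl (min δm (δ₁ / 2))) (m + 1)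
      swap
      · exact ⟨0, fun h => absurd h hl⟩
      have hsm := hbdV l hl.1
      by_cases hle : l ∈ SL (dl (min e ε')) (m + 1)
      · refine ⟨b l, fun _ => ⟨?_, ?_, fun _ => rfl⟩⟩
        · have := sup_eq hsm S LinearMap.id (by
            intro l' hl'
            have hA : l' ∈ SL (dl δm) m := V_sub_SL (A := {x | x ∈ l}) (fun x hx y hy =>
              lt_of_lt_of_le (hl.2 x hx y hy) (min_le_left _ _)) m hl'
            have hB : l' ∈ SL (dl e) m := V_sub_SL (A := {x | x ∈ l}) (fun x hx y hy =>
              lt_of_lt_of_le (hle.2 x hx y hy) (min_le_left _ _)) m hl'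
            exact (hS m le_rfl l' hA).2.2 hB)
          exact this.symm
        · refine b_mem ⟨hl.1, fun x hx y hy => ⟨⟨x, hx, by simpa using hε⟩,
            ⟨y, hy, by simpa using hε⟩, lt_of_lt_of_le (hle.2 x hx y hy) (min_le_right _ _)⟩⟩
      · obtain ⟨x, hx⟩ : ∃ x, x ∈ l := by
          rcases l with _ | ⟨x, l⟩
          · exact absurd hl.1 (by simp)
          · exact ⟨x, by simp⟩
        obtain ⟨w, hw, hbw⟩ := hF x m (S (bd (b l))) (by
          refine sup_ind hsm S _ fun l' hl' => ?_
          have hA : l' ∈ SL (dl δm) m := V_sub_SL (A := {x | x ∈ l}) (fun x hx y hy =>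
              lt_of_lt_of_le (hl.2 x hx y hy) (min_le_left _ _)) m hl'
          have key : ∀ u, (∃ y ∈ l', dist u y < min (δ₁ / 2) ε) → dist u x < δ₁ := by
            rintro u ⟨y, hy, huy⟩
            have h1 : dist y x < δ₁ / 2 :=
              lt_of_lt_of_le (hl.2 y (hl'.2 y hy) x hx) (min_le_right _ _)
            have h2 : dist u y < δ₁ / 2 := lt_of_lt_of_le huy (min_le_left _ _)
            have := dist_triangle u y x
            linarith
          refine R_mono ?_ m (hS m le_rfl l' hA).2.1
          rintro u v ⟨hu, hv, huv⟩
          exact ⟨key u hu, key v hv, lt_of_lt_of_le huv (min_le_left _ _)⟩) (hcyc l hl)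
        refine ⟨w, fun _ => ⟨hbw, R_mono ?_ _ hw, fun h => absurd h hle⟩⟩
        rintro u v ⟨hu, hv, huv⟩
        exact ⟨⟨x, hx, hu⟩, ⟨x, hx, hv⟩, huv⟩
    choose W hW using hex
    refine ⟨min e ε', lt_min he hε',
      ext fun l => if l.length = m + 1 then W l else S (b l), ?_⟩
    have hlow : ∀ k ≤ m, ∀ c ∈ R (dl (min δm (δ₁ / 2))) k,
        (ext fun l => if l.length = m + 1 then W l else S (b l)) c = S c := by
      intro k hk c hc
      refine sup_eq hc _ _ fun l hl => ?_
      rw [ext_b, if_neg (by rw [hl.1]; omega)]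
    intro k hk l hl
    rcases Nat.lt_or_ge m k with hmk | hmk
    · obtain rfl : k = m + 1 := by omega
      rw [hlow m le_rfl _ (bd_R (b_mem hl)), ext_b, if_pos hl.1]
      exact hW l hl
    · have hA : l ∈ SL (dl δm) k :=
        ⟨hl.1, fun x hx y hy => lt_of_lt_of_le (hl.2 x hx y hy) (min_le_left _ _)⟩
      rw [ext_b, if_neg (by rw [hl.1]; omega)]
      obtain ⟨h1, h2, h3⟩ := hS k hmk l hA
      refine ⟨?_, R_mono ?_ _ h2, fun h => h3 ?_⟩
      · rw [h1]
        rcases k with _ | k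
        · rw [bd_R_zero (b_mem hl)]; simp
        · rw [hlow k (by omega) _ (bd_R (b_mem hl))]
      · rintro u v ⟨⟨x, hx, hu⟩, ⟨y, hy, hv⟩, huv⟩
        exact ⟨⟨x, hx, lt_of_lt_of_le hu (min_le_right _ _)⟩,
          ⟨y, hy, lt_of_lt_of_le hv (min_le_right _ _)⟩, lt_of_lt_of_le huv (min_le_right _ _)⟩
      · exact ⟨h.1, fun x hx y hy => lt_of_lt_of_le (h.2 x hx y hy) (min_le_left _ _)⟩

/-- Injectivity: a fine cycle that bounds at a fixed coarse scale bounds at a fine scale. -/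
lemma inj_scale [MetricSpace X] [CompactSpace X] (hX : LCon X) (m : ℕ) : ∃ δ > 0,
    ∀ ε' > 0, ∃ ε'' > 0, ∀ k < m, ∀ z ∈ R (dl (X := X) ε'') k, ∀ w ∈ R (dl δ) (k + 1), bd w = z →
      ∃ w' ∈ R (dl ε') (k + 1), bd w' = z := by
  obtain ⟨δ, hδ, h⟩ := exists_S hX m 1 one_pos
  refine ⟨δ, hδ, fun ε' hε' => ?_⟩
  obtain ⟨e, he, S, hS⟩ := h ε' hε'
  refine ⟨min e δ, lt_min he hδ, ?_⟩
  intro k hk z hz w hw hbw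
  refine ⟨S w, ?_, ?_⟩
  · refine sup_ind hw S _ fun l hl => ?_
    exact R_mono (fun u v h => h.2.2) _ (hS _ hk l hl).2.1
  · have h1 := sup_eq hw (bd ∘ₗ S) (S ∘ₗ bd) (fun l hl => (hS _ hk l hl).1)
    have h2 := sup_eq hz S LinearMap.id (by
      intro l hl
      refine (hS k hk.le l ⟨hl.1, fun x hx y hy =>
        lt_of_lt_of_le (hl.2 x hx y hy) (min_le_right _ _)⟩).2.2 ⟨hl.1, fun x hx y hy =>
        lt_of_lt_of_le (hl.2 x hx y hy) (min_le_left _ _)⟩)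
    simp only [LinearMap.comp_apply, LinearMap.id_apply] at h1 h2
    rw [h1, hbw, h2]

end

end Ch

namespace Mink

lemma one_add_pow_form {A : Type*} [Ring A] (x : A) (s : ℕ) :
    ∃ y, (1 + x) ^ s = 1 + (s : ℤ) • x + x * x * y := by
  induction s with
  | zero => exact ⟨0, by simp⟩
  | succ s ih =>
    obtain ⟨y, hy⟩ := ih
    refine ⟨y + (s : ℤ) • 1 + y * x, ?_⟩
    rw [pow_succ, hy]
    simp only [mul_add, add_mul, mul_one, one_mul, Nat.cast_add, Nat.cast_one, add_smul,
      one_smul, smul_mul_assoc, mul_smul_comm, mul_assoc]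
    abel

variable {d : ℕ}


lemma eq_zero_of_div (M : Matrix (Fin d) (Fin d) ℤ) (h : ∀ a : ℕ, ∃ N : Matrix (Fin d) (Fin d) ℤ, M = (3:ℤ) ^ (a + 1) • N) : M = 0 := by
  ext i j
  by_contra hne
  simp only [Matrix.zero_apply] at hne
  obtain ⟨N, hN⟩ := h (M i j).natAbs
  have hd : (3:ℤ) ^ ((M i j).natAbs + 1) ∣ M i j := ⟨N i j, by
    conv_lhs => rw [hN]
    simp⟩
  have h1 := Int.natAbs_dvd_natAbs.2 hd
  have h2 := Nat.le_of_dvd (Int.natAbs_pos.2 hne) h1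
  rw [Int.natAbs_pow] at h2
  have h3 := Nat.lt_pow_self (n := (M i j).natAbs + 1) (a := 3) (by norm_num)
  have : (Int.natAbs 3) = 3 := rfl
  rw [this] at h2
  omega

lemma smul_cancel {m : ℤ} (hm : m ≠ 0) {A B : Matrix (Fin d) (Fin d) ℤ} (h : m • A = m • B) : A = B := by
  ext i j
  have := congrFun (congrFun h i) j
  simp only [Matrix.smul_apply, smul_eq_mul] at this
  exact mul_left_cancel₀ hm this

lemma case_coprime (N : Matrix (Fin d) (Fin d) ℤ) (s : ℕ) (hs : IsCoprime (s:ℤ) 3)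
    (h : (1 + (3:ℤ) • N) ^ s = 1) : (3:ℤ) • N = 0 := by
  apply eq_zero_of_div
  intro a
  induction a with
  | zero => exact ⟨N, by simp⟩
  | succ a ih =>
    obtain ⟨P, hP⟩ := ih
    rw [hP] at h
    obtain ⟨y, hy⟩ := one_add_pow_form ((3:ℤ) ^ (a + 1) • P) s
    rw [h] at hy
    have h1 : (3:ℤ) ^ (a+1) • ((s:ℤ) • P) = (3:ℤ) ^ (a + 1) • ((3:ℤ) ^ (a + 1) • (-(P * P * y))) := by
      have : (s:ℤ) • (3:ℤ) ^ (a+1) • P + ((3:ℤ) ^ (a+1) • P) * ((3:ℤ) ^ (a+1) • P) * y = 0 := by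
        rw [add_assoc] at hy
        exact (left_eq_add.1 hy)
      rw [smul_comm, eq_neg_of_add_eq_zero_left this]
      simp only [smul_mul_assoc, mul_smul_comm, smul_neg]
    have h2 := smul_cancel (by positivity) h1
    obtain ⟨u, v, huv⟩ := hs
    refine ⟨u • ((3:ℤ) ^ a • (-(P * P * y))) + v • P, ?_⟩
    rw [hP, pow_succ _ (a+1), mul_smul]
    congr 1
    calc P = (u * s + v * 3) • P := by rw [huv, one_smul]
      _ = u • ((s:ℤ) • P) + (3:ℤ) • (v • P) := by
        rw [add_smul, mul_smul, mul_comm v 3, mul_smul]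
      _ = _ := by
        rw [h2, smul_add, pow_succ, mul_comm, mul_smul, smul_comm u (3:ℤ)]

lemma case_three (N : Matrix (Fin d) (Fin d) ℤ) (h : (1 + (3:ℤ) • N) ^ 3 = 1) : (3:ℤ) • N = 0 := by
  apply eq_zero_of_div
  intro a
  induction a with
  | zero => exact ⟨N, by simp⟩
  | succ a ih =>
    obtain ⟨P, hP⟩ := ih
    rw [hP] at h
    have h0 : (3:ℤ) ^ (a + 2) • P = (3:ℤ) ^ (a + 2) •
        ((3:ℤ) • (-((3:ℤ) ^ a • (P * P) + (3:ℤ) ^ (2 * a) • (P * P * P)))) := by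
      have h1 : (1 + (3:ℤ) ^ (a + 1) • P) ^ 3 = 1 + (3:ℤ) ^ (a+2) • P
          + (3:ℤ) ^ (2 * a + 3) • (P * P) + (3:ℤ) ^ (3 * a + 3) • (P * P * P) := by
        set t : ℤ := (3:ℤ) ^ (a + 1) with ht
        have e1 : (3:ℤ) ^ (a+2) = 3 * t := by rw [ht]; ring
        have e2 : (3:ℤ) ^ (2*a+3) = 3 * (t * t) := by rw [ht]; ring
        have e3 : (3:ℤ) ^ (3*a+3) = t * t * t := by rw [ht]; ring
        rw [e1, e2, e3]
        simp only [pow_succ, pow_zero, one_mul, mul_add, add_mul, mul_one, smul_mul_assoc,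
          mul_smul_comm, mul_smul, mul_assoc, smul_add]
        have : ∀ Q : Matrix (Fin d) (Fin d) ℤ, (3:ℤ) • Q = Q + Q + Q := by intro Q; ext i j; simp; ring
        simp only [this]
        abel
      rw [h1] at h
      have h2 : (3:ℤ) ^ (a+2) • P
          + ((3:ℤ) ^ (2 * a + 3) • (P * P) + (3:ℤ) ^ (3 * a + 3) • (P * P * P)) = 0 := by
        rw [add_assoc, add_assoc] at h
        exact left_eq_add.1 h.symm
      rw [eq_neg_of_add_eq_zero_left h2]
      simp only [smul_neg, smul_add, smul_smul]
      congr 3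
      · congr 1; ring
      · congr 1; ring
    refine ⟨-((3:ℤ) ^ a • (P * P) + (3:ℤ) ^ (2 * a) • (P * P * P)), ?_⟩
    rw [hP, pow_succ _ (a+1), mul_smul]
    congr 1
    exact smul_cancel (by positivity) h0

lemma cong_torsion (s : ℕ) (hs : 0 < s) (N : Matrix (Fin d) (Fin d) ℤ) (h : (1 + (3:ℤ) • N) ^ s = 1) :
    (3:ℤ) • N = 0 := by
  induction s using Nat.strong_induction_on generalizing N with
  | _ s ih =>
    by_cases h3 : 3 ∣ s
    · obtain ⟨t, rfl⟩ := h3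
      apply case_three
      obtain ⟨y, hy⟩ := one_add_pow_form ((3:ℤ) • N) 3
      have hform : (1 + (3:ℤ) • N) ^ 3 = 1 + (3:ℤ) • ((3:ℤ) • N + N * ((3:ℤ) • N) * y) := by
        rw [hy]
        simp only [smul_add, smul_mul_assoc, Nat.cast_ofNat]
        rw [add_assoc]
      rw [pow_mul, hform] at h
      have := ih t (by omega) (by omega) _ h
      rw [hform, this, add_zero]
    · apply case_coprime N s _ h
      have : Nat.Coprime s 3 := ((Nat.Prime.coprime_iff_not_dvd (by norm_num)).2 h3).symm
      exact_mod_cast Nat.isCoprime_iff_coprime.2 this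

lemma matrix_bound (d : ℕ) : ∃ c > 0, ∀ g : Matrix (Fin d) (Fin d) ℤ, ∀ s > 0, g ^ s = 1 → g ^ c = 1 := by
  have : Fact (Nat.Prime 3) := ⟨by norm_num⟩
  refine ⟨Fintype.card (Matrix (Fin d) (Fin d) (ZMod 3))ˣ, Fintype.card_pos, ?_⟩
  intro g s hs hg
  set c := Fintype.card (Matrix (Fin d) (Fin d) (ZMod 3))ˣ
  set φ : (Matrix (Fin d) (Fin d) ℤ) →+* Matrix (Fin d) (Fin d) (ZMod 3) := (Int.castRingHom (ZMod 3)).mapMatrix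
  have hu : IsUnit (φ g) := by
    refine IsUnit.of_pow_eq_one (n := s) ?_ hs.ne'
    rw [← map_pow, hg, map_one]
  obtain ⟨u, hu⟩ := hu
  have h1 : φ (g ^ c) = 1 := by
    rw [map_pow, ← hu, ← Units.val_pow_eq_pow_val, pow_card_eq_one, Units.val_one]
  have h2 : ∀ i j, ∃ n : ℤ, (g ^ c - 1) i j = 3 * n := by
    intro i j
    have h3 : φ (g ^ c - 1) = 0 := by rw [map_sub, h1, map_one, sub_self]
    have h4 := congrFun (congrFun h3 i) j
    have h5 : (((g ^ c - 1) i j : ℤ) : ZMod 3) = 0 := h4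
    rw [ZMod.intCast_zmod_eq_zero_iff_dvd] at h5
    exact_mod_cast h5
  choose N hN using h2
  have h6 : g ^ c = 1 + (3:ℤ) • (Matrix.of N : Matrix (Fin d) (Fin d) ℤ) := by
    rw [← sub_eq_iff_eq_add']
    ext i j
    simpa using hN i j
  have h7 := cong_torsion s hs (Matrix.of N) (by
    rw [← h6, ← pow_mul, mul_comm, pow_mul, hg, one_pow])
  rw [h6, h7, add_zero]

lemma end_bound (k : ℕ) : ∃ c > 0, ∀ (L : Type) [AddCommGroup L]
    [Module.Free ℤ L] [Module.Finite ℤ L], Module.finrank ℤ L ≤ k →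
    ∀ g : Module.End ℤ L, ∀ s > 0, g ^ s = 1 → g ^ c = 1 := by
  choose c hc h using matrix_bound
  refine ⟨∏ j ∈ Finset.range (k + 1), c j, Finset.prod_pos fun j _ => hc j, ?_⟩
  intro L _ _ _ hL g s hs hg
  let B := Module.finBasis ℤ L
  let e := LinearMap.toMatrixAlgEquiv B
  have h1 := h _ (e g) s hs (by rw [← map_pow, hg, map_one])
  rw [← map_pow] at h1
  have h2 : g ^ c (Module.finrank ℤ L) = 1 := e.injective (by rw [h1, map_one])
  have h3 : c (Module.finrank ℤ L) ∣ ∏ j ∈ Finset.range (k + 1), c j :=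
    Finset.dvd_prod_of_mem _ (Finset.mem_range.2 (by omega))
  obtain ⟨t, ht⟩ := h3
  rw [ht, pow_mul, h2, one_pow]

/-- maps of a finitely generated abelian group to a lattice with kernel of bounded exponent -/
lemma lattice_map {Q : Type*} [AddCommGroup Q] (M : Submodule ℤ Q) (hM : M.FG) :
    ∃ (k : ℕ) (T : ℕ) (ψ : M →ₗ[ℤ] (Fin k → ℤ)), 0 < T ∧ ∀ m, ψ m = 0 → T • m = 0 := by
  have : Module.Finite ℤ M := Module.Finite.iff_fg.2 hM
  let t := Submodule.torsion ℤ M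
  have htfg : t.FG := IsNoetherian.noetherian t
  obtain ⟨S, hS⟩ := htfg
  have hT : ∃ T : ℕ, 0 < T ∧ ∀ m ∈ t, T • m = 0 := by
    have h1 : ∀ m : M, ∃ n : ℕ, 0 < n ∧ (m ∈ t → n • m = 0) := by
      intro m
      by_cases hm : m ∈ t
      · obtain ⟨⟨a, ha⟩, hm'⟩ := (Submodule.mem_torsion_iff m).1 hm
        have ha0 : a ≠ 0 := nonZeroDivisors.ne_zero ha
        refine ⟨a.natAbs, Int.natAbs_pos.2 ha0, fun _ => ?_⟩
        have hm'' : a • m = 0 := hm'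
        rw [← natCast_zsmul]
        rcases Int.natAbs_eq a with h | h
        · rw [← h]; exact hm''
        · have : ((a.natAbs : ℕ) : ℤ) = -a := by omega
          rw [this, neg_smul, hm'', neg_zero]
      · exact ⟨1, one_pos, fun h => absurd h hm⟩
    choose n hn hn' using h1
    refine ⟨∏ m ∈ S, n m, Finset.prod_pos fun m _ => hn m, ?_⟩
    intro m hm
    rw [← hS] at hm
    induction hm using Submodule.span_induction with
    | mem x hx =>
      obtain ⟨u, hu⟩ := Finset.dvd_prod_of_mem n hx
      rw [hu, mul_comm, mul_smul, hn' x (hS ▸ Submodule.subset_span hx), smul_zero]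
    | zero => simp
    | add x y _ _ hx hy => rw [smul_add, hx, hy, add_zero]
    | smul a x _ hx => rw [smul_comm, hx, smul_zero]
  obtain ⟨T, hT0, hT⟩ := hT
  let B := Module.finBasis ℤ (M ⧸ t)
  refine ⟨_, T, B.equivFun.toLinearMap ∘ₗ t.mkQ, hT0, ?_⟩
  intro m hm
  apply hT
  simp only [LinearMap.comp_apply, LinearEquiv.coe_coe, LinearEquiv.map_eq_zero_iff] at hm
  exact (Submodule.Quotient.mk_eq_zero t).1 hm

/-- Minkowski-type bound. -/
lemma bound {Q : Type*} [AddCommGroup Q] (M : Submodule ℤ Q) (hM : M.FG) :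
    ∃ c > 0, ∃ T > 0, ∀ (Z : Type _) [AddCommGroup Z] (f : Z →ₗ[ℤ] Q) (_ : ∀ z, f z ∈ M)
      (g : Module.End ℤ Z) (s : ℕ) (_ : 0 < s) (_ : g ^ s = 1) (_ : ∀ z, f z = 0 → f (g z) = 0),
      ∀ z, T • f ((g ^ c) z - z) = 0 := by
  obtain ⟨k, T, ψ, hT, hψ⟩ := lattice_map M hM
  obtain ⟨c, hc, hb⟩ := end_bound k
  refine ⟨c, hc, T, hT, ?_⟩
  intro Z _ f hf g s hs hg hker z
  let F : Z →ₗ[ℤ] (Fin k → ℤ) := ψ ∘ₗ f.codRestrict M hf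
  have hF : ∀ z, F z = 0 ↔ T • f z = 0 := by
    intro z
    constructor
    · intro h
      have := hψ _ h
      exact congrArg Subtype.val this
    · intro h
      have h1 : T • (f.codRestrict M hf z) = 0 := Subtype.ext h
      have h2 : T • F z = 0 := by
        change T • ψ (f.codRestrict M hf z) = 0
        rw [← map_nsmul, h1, map_zero]
      exact (smul_eq_zero.1 h2).resolve_left hT.ne'
  have hFg : ∀ z, F z = 0 → F (g z) = 0 := by
    intro z hz
    rw [hF] at hz ⊢
    rw [← map_nsmul] at hz
    have := hker _ hz
    rwa [map_nsmul, map_nsmul] at this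
  -- induced endomorphism of the range
  let L := LinearMap.range F
  have hex : ∀ x : L, ∃ z, F z = x := fun x => x.2
  choose σ hσ using hex
  have hwd : ∀ z z', F z = F z' → F (g z) = F (g z') := by
    intro z z' h
    have := hFg (z - z') (by rw [map_sub, h, sub_self])
    rw [map_sub, map_sub, sub_eq_zero] at this
    exact this
  let gL : Module.End ℤ L :=
    { toFun := fun x => ⟨F (g (σ x)), ⟨_, rfl⟩⟩
      map_add' := by
        intro x y
        apply Subtype.ext
        change F (g (σ (x + y))) = F (g (σ x)) + F (g (σ y))
        rw [← map_add, ← map_add]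
        apply hwd
        rw [map_add, hσ, hσ, hσ]; rfl
      map_smul' := by
        intro a x
        apply Subtype.ext
        change F (g (σ (a • x))) = a • F (g (σ x))
        rw [← map_smul, ← map_smul]
        apply hwd
        rw [map_smul, hσ, hσ]; rfl }
  have hgL : ∀ (n : ℕ) (z : Z), (gL ^ n) ⟨F z, ⟨z, rfl⟩⟩ = ⟨F ((g ^ n) z), ⟨_, rfl⟩⟩ := by
    intro n
    induction n with
    | zero => intro z; rfl
    | succ n ih =>
      intro z
      rw [pow_succ, pow_succ, Module.End.mul_apply, Module.End.mul_apply, ← ih (g z)]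
      congr 1
      apply Subtype.ext
      exact hwd _ _ (hσ _)
  have hs1 : gL ^ s = 1 := by
    ext1 x
    obtain ⟨_, z, rfl⟩ := x
    rw [hgL, hg]; rfl
  have hr : Module.finrank ℤ L ≤ k := by
    have := Submodule.finrank_le (R := ℤ) L
    simpa using this
  have h1 := hb L hr gL s hs hs1
  have h2 := hgL c z
  rw [h1] at h2
  rw [← hF, map_sub, sub_eq_zero]
  exact (congrArg Subtype.val h2).symm

end Mink

namespace Ch

noncomputable section

open Set Metric Topology

variable {X : Type*}

lemma V_finite {F : Set X} (hF : F.Finite) (k : ℕ) : (V F k).Finite := by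
  have : Finite F := hF
  refine ((List.finite_length_eq F k).image (List.map Subtype.val)).subset ?_
  intro l hl
  refine ⟨l.attach.map fun x => ⟨x.1, hl.2 x.1 x.2⟩, ?_, ?_⟩
  · simpa using hl.1
  · simp

lemma sup_fg {S : Set (List X)} (hS : S.Finite) : (sup S).FG := by
  unfold sup
  rw [Finsupp.supported_eq_span_single]
  exact Submodule.fg_span (hS.image _)

lemma unif [MetricSpace X] [CompactSpace X] {g : X → X} (hg : Continuous g) (ε : ℝ) (hε : 0 < ε) :
    ∃ δ > 0, ∀ x y, dist x y < δ → dist (g x) (g y) < ε := by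
  have := CompactSpace.uniformContinuous_of_continuous hg
  obtain ⟨δ, hδ, h⟩ := Metric.uniformContinuous_iff.1 this ε hε
  exact ⟨δ, hδ, fun x y hxy => h hxy⟩

lemma unif_fin [MetricSpace X] [CompactSpace X] {ι : Type*} (t : Finset ι) (g : ι → X → X)
    (hg : ∀ i, Continuous (g i)) (ε : ℝ) (hε : 0 < ε) :
    ∃ δ > 0, ∀ i ∈ t, ∀ x y, dist x y < δ → dist (g i x) (g i y) < ε := by
  choose d hd h using fun i => unif (hg i) ε hε
  obtain ⟨δ, hδ, hle⟩ := exists_pos_le t d hd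
  exact ⟨δ, hδ, fun i hi x y hxy => h i x y (hxy.trans_le (hle i hi))⟩

lemma top_bound_one [MetricSpace X] [CompactSpace X] (hX : LCon X) (k : ℕ) :
    ∃ c > 0, ∃ T > 0, ∀ (g : X → X) (_ : Continuous g) (s : ℕ) (_ : 0 < s)
      (_ : ∀ x, g^[s] x = x), ∀ τ' > 0, ∃ τ > 0, ∀ z ∈ R (dl (X := X) τ) k, bd z = 0 →
      ∃ w ∈ R (dl τ') (k + 1), bd w = T • (mp (g^[c]) z - z) := by
  obtain ⟨δ, hδ, hinj⟩ := inj_scale hX (k + 1)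
  -- finite net
  obtain ⟨F, hF, hcov⟩ : ∃ F : Set X, F.Finite ∧ ∀ x, ∃ y ∈ F, dist x y < δ / 3 := by
    obtain ⟨F, -, hF, h⟩ := finite_cover_balls_of_compact (isCompact_univ (X := X))
      (e := δ / 3) (by positivity)
    refine ⟨F, hF, fun x => ?_⟩
    have := h (mem_univ x)
    simpa using this
  choose f hfF hfd using hcov
  let B : Submodule ℤ (Ch X) := (R (dl δ) (k + 1)).map bd
  let M : Submodule ℤ (Ch X ⧸ B) := (sup (V F k)).map B.mkQ
  have hM : M.FG := (sup_fg (V_finite hF k)).map _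
  obtain ⟨c, hc, T, hT, hb⟩ := Mink.bound M hM
  refine ⟨c, hc, T, hT, ?_⟩
  intro g hg s hs hgs τ' hτ'
  obtain ⟨e, he, hge⟩ := unif hg δ hδ
  obtain ⟨e2, he2, hinj⟩ := hinj (min e τ') (lt_min he hτ')
  obtain ⟨τ, hτ, hgτ⟩ := unif_fin (Finset.range s) (fun j => g^[j]) (fun j => hg.iterate j)
    (min e2 (δ / 3)) (lt_min he2 (by positivity))
  refine ⟨τ, hτ, ?_⟩
  let E : X → X → Prop := fun x y => ∀ j : ℕ, dist (g^[j] x) (g^[j] y) < min e2 (δ / 3)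
  have hEg : ∀ x y, E x y → E (g x) (g y) := fun x y h j => by
    have := h (j + 1)
    simpa [Function.iterate_succ_apply] using this
  have hE2 : ∀ x y, E x y → dl e2 x y := fun x y h => lt_of_lt_of_le (h 0) (min_le_left _ _)
  have hE3 : ∀ x y, E x y → dist x y < δ / 3 := fun x y h => lt_of_lt_of_le (h 0) (min_le_right _ _)
  have hmod : ∀ (j : ℕ) x, g^[j] x = g^[j % s] x := by
    intro j x
    have h1 : ∀ t : ℕ, ∀ x, g^[s * t] x = x := by
      intro t
      induction t with
      | zero => intro x; rfl
      | succ t ih => intro x; rw [Nat.mul_succ, Function.iterate_add_apply, hgs, ih]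
    conv_lhs => rw [← Nat.mod_add_div j s, Function.iterate_add_apply, h1]
  have hτE : ∀ x y, dl τ x y → E x y := by
    intro x y h j
    rw [hmod j x, hmod j y]
    exact hgτ _ (Finset.mem_range.2 (Nat.mod_lt _ hs)) x y h
  let Z : Submodule ℤ (Ch X) := R E k ⊓ LinearMap.ker bd
  have hZg : ∀ z ∈ Z, mp g z ∈ Z := by
    rintro z ⟨h1, h2⟩
    refine ⟨mp_R hEg h1, ?_⟩
    replace h2 : bd z = 0 := h2
    change bd (mp g z) = 0
    rw [← mp_bd, h2, map_zero]
  let gZ : Module.End ℤ Z := (mp g).restrict hZg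
  have hgZ : ∀ (j : ℕ) (z : Z), (((gZ ^ j) z : Z) : Ch X) = mp (g^[j]) z := by
    intro j
    induction j with
    | zero => intro z; exact (mp_id _ (fun x => rfl) _).symm
    | succ j ih =>
      intro z
      rw [pow_succ, Module.End.mul_apply, ih]
      change mp _ (mp g z) = _
      rw [mp_mp]
      rfl
  have hbZ : ∀ z ∈ Z, z ∈ B → ∃ w ∈ R (dl (min e τ')) (k + 1), bd w = z := by
    rintro z ⟨h1, _⟩ ⟨w, hw, hbw⟩
    exact hinj k (Nat.lt_succ_self k) z (R_mono hE2 k h1) w hw hbw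
  intro z hz hbz
  have hzZ : z ∈ Z := ⟨R_mono hτE k hz, hbz⟩
  have key := hb Z (B.mkQ ∘ₗ Z.subtype) (by
    rintro ⟨z, h1, h2⟩
    refine ⟨mp f z, ?_, ?_⟩
    · refine sup_ind h1 _ _ fun l hl => ?_
      rw [mp_b]
      refine b_mem ⟨by simp [hl.1], ?_⟩
      simp only [List.mem_map]
      rintro _ ⟨x, _, rfl⟩
      exact hfF x
    · change B.mkQ (mp f z) = B.mkQ z
      rw [← sub_eq_zero, ← map_sub, Submodule.mkQ_apply, Submodule.Quotient.mk_eq_zero]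
      refine ⟨pr (fun x => x) f z, ?_, ?_⟩
      · refine pr_R ?_ h1
        intro x y hxy
        have h3 := hE3 x y hxy
        have h4 := hfd x
        have h5 := hfd y
        have h6 := dist_triangle x y (f y)
        have h7 := dist_triangle_left (f x) y x
        have h8 := dist_triangle (f x) y (f y)
        simp only [dl]
        refine ⟨?_, ?_, ?_, ?_⟩ <;> linarith
      · replace h2 : bd z = 0 := h2
        rw [bd_pr, h2, map_zero, sub_zero, mp_id (fun x => x) (fun _ => rfl)]) gZ s hs (by
    ext1 z
    apply Subtype.ext
    rw [hgZ]
    exact mp_id _ hgs _) (by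
    rintro ⟨z, hz⟩ h
    change B.mkQ z = 0 at h
    change B.mkQ (mp g z) = 0
    rw [Submodule.mkQ_apply, Submodule.Quotient.mk_eq_zero] at h ⊢
    obtain ⟨w, hw, hbw⟩ := hbZ z hz h
    refine ⟨mp g w, mp_R ?_ hw, ?_⟩
    · intro x y hxy
      exact hge x y (lt_of_lt_of_le hxy (min_le_left _ _))
    · rw [← mp_bd, hbw]) ⟨z, hzZ⟩
  rw [← map_nsmul] at key
  have hmem : ((T • ((gZ ^ c) ⟨z, hzZ⟩ - ⟨z, hzZ⟩) : Z) : Ch X) ∈ B := by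
    rw [← Submodule.Quotient.mk_eq_zero]
    exact key
  obtain ⟨w, hw, hbw⟩ := hbZ _ (Subtype.mem _) hmem
  refine ⟨w, R_mono (fun x y h => lt_of_lt_of_le h (min_le_right _ _)) _ hw, ?_⟩
  rw [hbw, ← hgZ c ⟨z, hzZ⟩]
  rfl

lemma top_bound [MetricSpace X] [CompactSpace X] (hX : LCon X) (m : ℕ) :
    ∃ c > 0, ∃ T > 0, ∀ (g : X → X) (_ : Continuous g) (s : ℕ) (_ : 0 < s)
      (_ : ∀ x, g^[s] x = x), ∀ k < m, ∀ τ' > 0, ∃ τ > 0,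
      ∀ z ∈ R (dl (X := X) τ) k, bd z = 0 →
      ∃ w ∈ R (dl τ') (k + 1), bd w = T • (mp (g^[c]) z - z) := by
  choose c hc T hT h using top_bound_one hX
  refine ⟨∏ j ∈ Finset.range m, c j, Finset.prod_pos fun j _ => hc j,
    ∏ j ∈ Finset.range m, T j, Finset.prod_pos fun j _ => hT j, ?_⟩
  intro g hg s hs hgs k hk τ' hτ'
  obtain ⟨u, hu⟩ := Finset.dvd_prod_of_mem c (Finset.mem_range.2 hk)
  obtain ⟨v, hv⟩ := Finset.dvd_prod_of_mem T (Finset.mem_range.2 hk)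
  obtain ⟨τ, hτ, hh⟩ := h k (g^[u]) (hg.iterate u) s hs (by
    intro x
    rw [← Function.iterate_mul, mul_comm, Function.iterate_mul]
    have : g^[s] = id := funext hgs
    rw [this, Function.iterate_id]; rfl) τ' hτ'
  refine ⟨τ, hτ, fun z hz hbz => ?_⟩
  obtain ⟨w, hw, hbw⟩ := hh z hz hbz
  refine ⟨v • w, Submodule.smul_of_tower_mem _ v hw, ?_⟩
  rw [map_nsmul, hbw, hu, hv, mul_comm (T k) v, mul_smul, mul_comm (c k) u, Function.iterate_mul]

end

end Ch

namespace Ch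

noncomputable section

section coh

variable {G : Type*} [CommGroup G] {L : Type*} [AddCommGroup L]

/-- prism maps and maps -/
lemma mp_pr {X Y Z : Type*} (u : Y → Z) (f g : X → Y) (c : Ch X) :
    mp u (pr f g c) = pr (fun x => u (f x)) (fun x => u (g x)) c := by
  have := hom_ext' (f := mp u ∘ₗ pr f g) (g := pr (fun x => u (f x)) (fun x => u (g x))) (by
    intro l
    induction l with
    | nil => simp
    | cons x l ih =>
      simp only [LinearMap.comp_apply] at ih
      simp [mp_cone, ih, Function.comp_def]) c
  simpa using this

lemma pr_mp {X Y Z : Type*} (u : X → Y) (f g : Y → Z) (c : Ch X) :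
    pr f g (mp u c) = pr (fun x => f (u x)) (fun x => g (u x)) c := by
  have := hom_ext' (f := pr f g ∘ₗ mp u) (g := pr (fun x => f (u x)) (fun x => g (u x))) (by
    intro l
    induction l with
    | nil => simp
    | cons x l ih =>
      simp only [LinearMap.comp_apply, mp_b] at ih
      simp [ih, Function.comp_def]) c
  simpa using this

/-- one step: replacing a cocycle by its pullback under an idempotent endomorphism -/
lemma coh_step (o : Ch G →ₗ[ℤ] L) (hinv : ∀ (g : G) c, o (mp (g * ·) c) = o c)
    (hco : ∀ c, o (bd c) = 0) (π : G →* G) (hπ : ∀ g, π (π g) = π g) (K : Finset G)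
    (hK : ∀ t, t ∈ K ↔ π t = 1) :
    ∃ h : Ch G →ₗ[ℤ] L, (∀ (g : G) c, h (mp (g * ·) c) = h c) ∧
      ∀ c, h (bd c) = K.card • (o (mp π c) - o c) := by
  classical
  refine ⟨∑ t ∈ K, o ∘ₗ pr id π ∘ₗ mp (t * ·), ?_, ?_⟩
  · intro g c
    simp only [LinearMap.sum_apply, LinearMap.comp_apply, mp_mp]
    have hg : π (g * (π g)⁻¹) = 1 := by simp [hπ]
    refine Finset.sum_bij (fun t _ => t * (g * (π g)⁻¹)) ?_ ?_ ?_ ?_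
    · intro t ht
      rw [hK] at ht ⊢
      rw [map_mul, ht, hg, one_mul]
    · intro a _ b _ h
      exact mul_right_cancel h
    · intro t ht
      refine ⟨t * (g * (π g)⁻¹)⁻¹, ?_, by group⟩
      rw [hK] at ht ⊢
      rw [map_mul, ht, map_inv, hg]; simp
    · intro t ht
      rw [hK] at ht
      rw [pr_mp, pr_mp]
      conv_rhs => rw [← hinv (π g), mp_pr]
      congr 3
      · funext x
        simp only [id]
        calc t * (g * x) = t * (g * ((π g)⁻¹ * π g)) * x := by simp [mul_assoc]
          _ = _ := by ac_rfl
      · funext x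
        simp [ht, hπ]
  · intro c
    simp only [LinearMap.sum_apply, LinearMap.comp_apply]
    rw [← Finset.sum_const]
    refine Finset.sum_congr rfl fun t ht => ?_
    rw [hK] at ht
    have h1 := bd_pr id π (mp (t * ·) c)
    have h2 : mp π (mp (t * ·) c) = mp π c := by
      rw [mp_mp]; congr 2; funext x; simp [ht]
    have h3 := congrArg o h1
    rw [hco, map_sub, map_sub, h2, mp_id id (fun _ => rfl), hinv] at h3
    rw [mp_bd, ← sub_eq_zero.1 h3.symm]

end coh

section coh2

variable {L : Type*} [AddCommGroup L] {m r : ℕ}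

/-- killing the coordinates in `s` -/
def killHom (m r : ℕ) (s : Finset (Fin m)) :
    Multiplicative (Fin m → ZMod r) →* Multiplicative (Fin m → ZMod r) :=
  AddMonoidHom.toMultiplicative
    { toFun := fun v i => if i ∈ s then 0 else v i
      map_zero' := by funext i; simp
      map_add' := by intro v w; funext i; by_cases h : i ∈ s <;> simp [h] }

lemma killHom_apply (s : Finset (Fin m)) (v : Multiplicative (Fin m → ZMod r)) (i : Fin m) :
    (killHom m r s v).toAdd i = if i ∈ s then 0 else v.toAdd i := rfl

lemma coh_main [NeZero r] (o : Ch (Multiplicative (Fin m → ZMod r)) →ₗ[ℤ] L)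
    (hinv : ∀ (g : Multiplicative (Fin m → ZMod r)) c, o (mp (g * ·) c) = o c)
    (hco : ∀ c, o (bd c) = 0) :
    ∃ h : Ch (Multiplicative (Fin m → ZMod r)) →ₗ[ℤ] L,
      (∀ (g : Multiplicative (Fin m → ZMod r)) c, h (mp (g * ·) c) = h c) ∧
      ∀ c, h (bd c) = r • o c := by
  classical
  have key : ∀ s : Finset (Fin m), ∃ h : Ch (Multiplicative (Fin m → ZMod r)) →ₗ[ℤ] L,
      (∀ (g : Multiplicative (Fin m → ZMod r)) c, h (mp (g * ·) c) = h c) ∧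
      ∀ c, h (bd c) = r • (o (mp (killHom m r s) c) - o c) := by
    intro s
    induction s using Finset.induction_on with
    | empty =>
      refine ⟨0, by simp, fun c => ?_⟩
      rw [mp_id]
      · simp
      · intro x
        apply Multiplicative.toAdd.injective
        funext i
        rw [killHom_apply]; simp
    | insert j s hj ih =>
      obtain ⟨h1, h1i, h1b⟩ := ih
      obtain ⟨h2, h2i, h2b⟩ := coh_step (o ∘ₗ mp (killHom m r s)) (by
          intro g c
          simp only [LinearMap.comp_apply, mp_mp]
          rw [← hinv (killHom m r s g) (mp (killHom m r s) c), mp_mp]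
          simp) (by
          intro c
          simp only [LinearMap.comp_apply, mp_bd, hco]) (killHom m r {j}) (by
          intro g
          apply Multiplicative.toAdd.injective
          funext i
          simp only [killHom_apply]
          split_ifs <;> rfl) (Finset.univ.image fun x : ZMod r =>
            Multiplicative.ofAdd (Pi.single j x)) (by
          intro t
          simp only [Finset.mem_image, Finset.mem_univ, true_and]
          constructor
          · rintro ⟨x, rfl⟩
            apply Multiplicative.toAdd.injective
            funext i
            simp only [killHom_apply]
            by_cases h : i = j <;> simp [h]
          · intro h
            refine ⟨t.toAdd j, ?_⟩
            apply Multiplicative.toAdd.injective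
            funext i
            have := congrArg (fun v => v.toAdd i) h
            simp only [killHom_apply] at this
            by_cases hi : i = j
            · subst hi; simp
            · simp [hi] at this; simp [hi, this])
      refine ⟨h1 + h2, ?_, ?_⟩
      · intro g c
        simp [h1i, h2i]
      · intro c
        have hcard : (Finset.univ.image fun x : ZMod r =>
            (Multiplicative.ofAdd (Pi.single j x : Fin m → ZMod r))).card = r := by
          rw [Finset.card_image_of_injective]
          · simp [ZMod.card]
          · intro x y hxy
            exact Pi.single_injective j (Multiplicative.ofAdd.injective hxy)
        have h3 : mp (killHom m r s) (mp (killHom m r {j}) c) = mp (killHom m r (insert j s)) c := by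
          rw [mp_mp]
          congr 2
          funext x
          apply Multiplicative.toAdd.injective
          funext i
          simp only [killHom_apply, Finset.mem_insert, Finset.mem_singleton]
          by_cases h : i = j <;> by_cases h' : i ∈ s <;> simp [h, h']
        rw [LinearMap.add_apply, h1b, h2b, hcard]
        simp only [LinearMap.comp_apply, h3]
        rw [← smul_add]
        congr 1
        abel
  obtain ⟨h, hi, hb⟩ := key Finset.univ
  have hk : ∀ x, killHom m r Finset.univ x = 1 := by
    intro x
    apply Multiplicative.toAdd.injective
    funext i
    simp [killHom_apply]
  refine ⟨r • (o ∘ₗ cone 1 ∘ₗ mp (killHom m r Finset.univ)) - h, ?_, ?_⟩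
  · intro g c
    simp only [LinearMap.sub_apply, LinearMap.smul_apply, LinearMap.comp_apply, hi, mp_mp]
    congr 6
    funext x
    simp [hk]
  · intro c
    simp only [LinearMap.sub_apply, LinearMap.smul_apply, LinearMap.comp_apply, hb]
    have h1 := congrArg o (bd_cone 1 (mp (killHom m r Finset.univ) c))
    rw [hco, map_sub] at h1
    rw [mp_bd, ← sub_eq_zero.1 h1.symm, smul_sub]
    abel

end coh2

end

end Ch

namespace Ch

noncomputable section

open Set Metric Topology

section

variable {G : Type*} [Group G]

/-- equivariant choice on nonempty lists of group elements -/
lemma eqv_choice {M : Type*} [Nonempty M] (act : G → M → M)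
    (hmul : ∀ g h y, act (g * h) y = act g (act h y))
    (P : List G → M → Prop) (hP : ∀ g l y, P l y → P (l.map (g * ·)) (act g y)) (k : ℕ)
    (hk : 1 ≤ k) (hex : ∀ l, l.length = k → ∃ y, P l y) :
    ∃ f : List G → M, (∀ l, l.length = k → P l (f l)) ∧
      ∀ g l, l.length = k → f (l.map (g * ·)) = act g (f l) := by
  classical
  choose! f0 hf0 using hex
  let hd : List G → G := fun l => l.headD 1
  have hhd : ∀ g l, l.length = k → hd (l.map (g * ·)) = g * hd l := by
    intro g l hl
    rcases l with _ | ⟨x, l⟩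
    · simp at hl; omega
    · simp [hd]
  refine ⟨fun l => act (hd l) (f0 (l.map ((hd l)⁻¹ * ·))), ?_, ?_⟩
  · intro l hl
    have := hP (hd l) _ _ (hf0 (l.map ((hd l)⁻¹ * ·)) (by simpa using hl))
    simpa [List.map_map, Function.comp_def] using this
  · intro g l hl
    simp only [hhd g l hl]
    rw [hmul]
    congr 3
    rw [List.map_map]
    congr 1
    funext x
    simp [mul_assoc]

variable {X : Type*} [MulAction G X]

/-- equivariant chain maps, small with respect to `E`, defined up to length `k` -/
def IsEq (E : X → X → Prop) (k : ℕ) (φ : Ch G →ₗ[ℤ] Ch X) : Prop :=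
  ∀ l : List G, l.length ≤ k → φ (b l) ∈ R E l.length ∧ bd (φ (b l)) = φ (bd (b l)) ∧
    ∀ g : G, φ (b (l.map (g * ·))) = mp (g • ·) (φ (b l))

lemma bd_V {Y : Type*} {k : ℕ} {l : List Y} (hl : l.length = k + 1) :
    bd (b l) ∈ sup (V (univ : Set Y) k) := by
  have := bd_b_V l
  rw [hl] at this
  exact Finsupp.supported_mono (V_mono (subset_univ _) _) this

lemma mp_V {Y : Type*} {k : ℕ} (f : Y → Y) {c : Ch Y} (hc : c ∈ sup (V (univ : Set Y) k)) :
    mp f c ∈ sup (V (univ : Set Y) k) := by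
  refine sup_ind hc _ _ fun l hl => ?_
  rw [mp_b]
  exact b_mem ⟨by simp [hl.1], by simp⟩

lemma IsEq.mem {E : X → X → Prop} {k : ℕ} {φ : Ch G →ₗ[ℤ] Ch X} (h : IsEq E k φ) {j : ℕ}
    (hj : j ≤ k) {c : Ch G} (hc : c ∈ sup (V univ j)) : φ c ∈ R E j := by
  refine sup_ind hc _ _ fun l hl => ?_
  have := (h l (hl.1.trans_le hj)).1
  rwa [hl.1] at this

lemma IsEq.bd {E : X → X → Prop} {k : ℕ} {φ : Ch G →ₗ[ℤ] Ch X} (h : IsEq E k φ) {j : ℕ}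
    (hj : j ≤ k) {c : Ch G} (hc : c ∈ sup (V univ j)) : Ch.bd (φ c) = φ (Ch.bd c) := by
  exact sup_eq hc (Ch.bd ∘ₗ φ) (φ ∘ₗ Ch.bd) fun l hl => (h l (hl.1.trans_le hj)).2.1

lemma IsEq.eqv {E : X → X → Prop} {k : ℕ} {φ : Ch G →ₗ[ℤ] Ch X} (h : IsEq E k φ) {j : ℕ}
    (hj : j ≤ k) (g : G) {c : Ch G} (hc : c ∈ sup (V univ j)) :
    φ (mp (g * ·) c) = mp (g • ·) (φ c) := by
  exact sup_eq hc (φ ∘ₗ mp (g * ·)) (mp (g • ·) ∘ₗ φ) fun l hl => by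
    have := (h l (hl.1.trans_le hj)).2.2 g
    simpa using this

lemma mp_smul_mul (g h : G) (c : Ch X) : mp ((g * h) • ·) c = mp (g • ·) (mp (h • ·) c) := by
  rw [mp_mp]; simp only [mul_smul]

lemma mp_one_smul (c : Ch X) : mp ((1 : G) • ·) c = c := mp_id _ (one_smul G) c

lemma fillStep {E E' : X → X → Prop} (hE : ∀ x y, E x y → E' x y)
    (hE' : ∀ (g : G) x y, E' x y → E' (g • x) (g • y)) {k : ℕ}
    {φ : Ch G →ₗ[ℤ] Ch X} (hφ : IsEq E k φ) (T : ℕ)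
    (hfill : ∀ l : List G, l.length = k + 1 → ∃ y ∈ R E' (k + 1), bd y = T • φ (bd (b l))) :
    ∃ φ' : Ch G →ₗ[ℤ] Ch X, IsEq E' (k + 1) φ' ∧ φ' (b []) = T • φ (b []) := by
  classical
  obtain ⟨f, hf, hfe⟩ := eqv_choice (fun g : G => mp (X := X) (g • ·)) mp_smul_mul
    (fun l y => l.length = k + 1 → y ∈ R E' (k + 1) ∧ bd y = T • φ (bd (b l))) (by
      intro g l y h hl
      obtain ⟨h1, h2⟩ := h (by simpa using hl)
      refine ⟨mp_R (hE' g) h1, ?_⟩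
      rw [← mp_bd, h2, map_nsmul, ← hφ.eqv le_rfl g (bd_V (by simpa using hl)), mp_bd, mp_b])
    (k + 1) (by omega) (fun l hl => by
      obtain ⟨y, h1, h2⟩ := hfill l hl
      exact ⟨y, fun _ => ⟨h1, h2⟩⟩)
  let φ' : Ch G →ₗ[ℤ] Ch X := ext fun l => if l.length = k + 1 then f l else T • φ (b l)
  have h1 : ∀ l, l.length = k + 1 → φ' (b l) = f l := fun l hl => by simp [φ', hl]
  have h2 : ∀ l, l.length ≠ k + 1 → φ' (b l) = T • φ (b l) := fun l hl => by
    simp only [φ', ext_b, if_neg hl]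
  have h3 : ∀ j ≠ k + 1, ∀ c ∈ sup (V univ j), φ' c = T • φ c := fun j hj c hc =>
    sup_eq hc φ' (T • φ) fun l hl => h2 l (by rw [hl.1]; exact hj)
  refine ⟨φ', ?_, h2 [] (by simp)⟩
  intro l hl
  by_cases hlk : l.length = k + 1
  · obtain ⟨h4, h5⟩ := hf l hlk hlk
    refine ⟨by rw [h1 l hlk, hlk]; exact h4, ?_, fun g => ?_⟩
    · rw [h1 l hlk, h5, h3 k (by omega) _ (bd_V hlk)]
    · rw [h1 l hlk, h1 _ (by simpa using hlk), hfe g l hlk]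
  · obtain ⟨h4, h5, h6⟩ := hφ l (by omega)
    rw [h2 l hlk]
    refine ⟨Submodule.smul_of_tower_mem _ _ (R_mono hE _ h4), ?_, fun g => ?_⟩
    · rw [map_nsmul, h5]
      rcases hl0 : l.length with _ | j
      · rw [List.length_eq_zero_iff] at hl0
        subst hl0
        simp
      · rw [h3 j (by omega) _ (bd_V hl0)]
    · rw [h2 _ (by simpa using hlk), h6, map_nsmul]

lemma baseEq {E : X → X → Prop} (hE : ∀ x, E x x) (x₀ : X) :
    ∃ φ : Ch G →ₗ[ℤ] Ch X, IsEq E 1 φ ∧ φ (b []) = b [] := by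
  refine ⟨mp fun g => g • x₀, ?_, by simp⟩
  intro l hl
  refine ⟨?_, (mp_bd _ _).symm, fun g => ?_⟩
  · rw [mp_b]
    refine b_mem ⟨by simp, ?_⟩
    rcases l with _ | ⟨x, _ | ⟨y, l⟩⟩
    · simp
    · simp [hE]
    · simp at hl
  · simp [List.map_map, Function.comp_def, mul_smul]

end

section

variable {m r : ℕ} {X : Type*} [MulAction (Multiplicative (Fin m → ZMod r)) X]


lemma obstruct [NeZero r] {E : X → X → Prop}
    (hE : ∀ (g : (Multiplicative (Fin m → ZMod r))) x y, E x y → E (g • x) (g • y)) {k : ℕ} (hk : 1 ≤ k)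
    {φ : Ch (Multiplicative (Fin m → ZMod r)) →ₗ[ℤ] Ch X} (hφ : IsEq E k φ) (T : ℕ) (B : Submodule ℤ (Ch X))
    (hB : ∀ (g : (Multiplicative (Fin m → ZMod r))), ∀ z ∈ R E k, bd z = 0 → T • (mp (g • ·) z - z) ∈ B) :
    ∃ φ' : Ch (Multiplicative (Fin m → ZMod r)) →ₗ[ℤ] Ch X, IsEq E k φ' ∧ φ' (b []) = r • φ (b []) ∧
      ∀ l, l.length = k + 1 → T • φ' (bd (b l)) ∈ B := by
  classical
  let Z : Submodule ℤ (Ch X) := R E k ⊓ LinearMap.ker bd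
  let N : Submodule ℤ Z := B.comap (T • Z.subtype)
  have hNmem : ∀ z : Z, z ∈ N ↔ T • z.1 ∈ B := fun z => Iff.rfl
  have hZg : ∀ (g : (Multiplicative (Fin m → ZMod r))), ∀ z ∈ Z, mp (g • ·) z ∈ Z := by
    rintro g z ⟨h1, h2⟩
    replace h2 : bd z = 0 := h2
    refine ⟨mp_R (hE g) h1, ?_⟩
    change bd (mp _ z) = 0
    rw [← mp_bd, h2, map_zero]
  have hgN : ∀ (g : (Multiplicative (Fin m → ZMod r))) (z : Z), N.mkQ ⟨mp (g • ·) z.1, hZg g _ z.2⟩ = N.mkQ z := by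
    intro g z
    rw [← sub_eq_zero, ← map_sub, Submodule.mkQ_apply, Submodule.Quotient.mk_eq_zero, hNmem]
    exact hB g z.1 z.2.1 z.2.2
  have hZ : ∀ c ∈ sup (V univ (k + 1)), φ (bd c) ∈ Z := by
    intro c hc
    refine sup_ind hc (φ ∘ₗ bd) _ fun l hl => ?_
    refine ⟨hφ.mem le_rfl (bd_V hl.1), ?_⟩
    change bd (φ (bd (b l))) = 0
    rw [hφ.bd le_rfl (bd_V hl.1), bd_bd, map_zero]
  have hbl : ∀ l : List (Multiplicative (Fin m → ZMod r)), l.length = k + 1 → b l ∈ sup (V univ (k + 1)) := fun l hl =>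
    b_mem ⟨hl, by simp⟩
  let o : Ch (Multiplicative (Fin m → ZMod r)) →ₗ[ℤ] (Z ⧸ N) := ext fun l =>
    if h : l.length = k + 1 then N.mkQ ⟨φ (bd (b l)), hZ _ (hbl l h)⟩ else 0
  have ho1 : ∀ l (h : l.length = k + 1), o (b l) = N.mkQ ⟨φ (bd (b l)), hZ _ (hbl l h)⟩ :=
    fun l h => by simp only [o, ext_b, dif_pos h]
  have ho2 : ∀ l, l.length ≠ k + 1 → o (b l) = 0 := fun l h => by
    simp only [o, ext_b, dif_neg h]
  have hoc : ∀ c ∈ sup (V univ (k + 1)), ∃ z : Z, z.1 = φ (bd c) ∧ N.mkQ z = o c := by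
    intro c hc
    have := sup_ind hc (o.prod (φ ∘ₗ bd)) (LinearMap.range (N.mkQ.prod Z.subtype)) (by
      intro l hl
      exact ⟨⟨φ (bd (b l)), hZ _ (hbl l hl.1)⟩, Prod.ext (ho1 l hl.1).symm rfl⟩)
    obtain ⟨z, hz⟩ := this
    exact ⟨z, congrArg Prod.snd hz, congrArg Prod.fst hz⟩
  obtain ⟨h, hinv, hbd⟩ := coh_main o (by
    intro g c
    refine hom_ext' (f := o ∘ₗ mp (g * ·)) (g := o) ?_ c
    intro l
    rw [LinearMap.comp_apply, mp_b]
    by_cases hl : l.length = k + 1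
    · rw [ho1 l hl, ho1 _ (by simpa using hl)]
      conv_rhs => rw [← hgN g]
      congr 1
      apply Subtype.ext
      change φ _ = mp _ (φ (bd (b l)))
      rw [← hφ.eqv le_rfl g (bd_V hl), mp_bd, mp_b]
    · rw [ho2 l hl, ho2 _ (by simpa using hl)]) (by
    intro c
    refine hom_ext' (f := o ∘ₗ bd) (g := 0) ?_ c
    intro l
    rw [LinearMap.comp_apply, LinearMap.zero_apply]
    rcases hl : l.length with _ | j
    · rw [List.length_eq_zero_iff] at hl
      subst hl
      simp
    · have h1 := bd_V hl
      by_cases hj : j = k + 1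
      · subst hj
        obtain ⟨z, h2, h3⟩ := hoc _ h1
        rw [← h3]
        have : z = 0 := Subtype.ext (by rw [h2, bd_bd, map_zero]; rfl)
        rw [this, map_zero]
      · exact sup_eq h1 o 0 fun l' hl' => ho2 l' (by rw [hl'.1]; exact hj))
  obtain ⟨f, hf, hfe⟩ := eqv_choice (fun g : (Multiplicative (Fin m → ZMod r)) => mp (X := X) (g • ·)) mp_smul_mul
    (fun l y => ∃ hy : y ∈ Z, N.mkQ ⟨y, hy⟩ = h (b l)) (by
      rintro g l y ⟨hy, h1⟩
      refine ⟨hZg g y hy, ?_⟩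
      rw [hgN g ⟨y, hy⟩, h1, ← hinv g, mp_b])
    k hk (by
      intro l hl
      obtain ⟨z, hz⟩ := N.mkQ_surjective (h (b l))
      exact ⟨z.1, z.2, hz⟩)
  have hfZ : ∀ l, l.length = k → f l ∈ Z := fun l hl => (hf l hl).1
  let η : Ch (Multiplicative (Fin m → ZMod r)) →ₗ[ℤ] Ch X := ext f
  have hηc : ∀ c ∈ sup (V univ k), ∃ z : Z, z.1 = η c ∧ N.mkQ z = h c := by
    intro c hc
    have := sup_ind hc (h.prod η) (LinearMap.range (N.mkQ.prod Z.subtype)) (by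
      intro l hl
      refine ⟨⟨f l, hfZ l hl.1⟩, Prod.ext (hf l hl.1).2 ?_⟩
      simp [η])
    obtain ⟨z, hz⟩ := this
    exact ⟨z, congrArg Prod.snd hz, congrArg Prod.fst hz⟩
  let φ' : Ch (Multiplicative (Fin m → ZMod r)) →ₗ[ℤ] Ch X := ext fun l => if l.length = k then r • φ (b l) - f l else r • φ (b l)
  have h1 : ∀ l, l.length = k → φ' (b l) = r • φ (b l) - f l := fun l hl => by simp [φ', hl]
  have h2 : ∀ l, l.length ≠ k → φ' (b l) = r • φ (b l) := fun l hl => by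
    simp only [φ', ext_b, if_neg hl]
  have h3 : ∀ j ≠ k, ∀ c ∈ sup (V univ j), φ' c = r • φ c := fun j hj c hc =>
    sup_eq hc φ' (r • φ) fun l hl => h2 l (by rw [hl.1]; exact hj)
  have h3' : ∀ c ∈ sup (V univ k), φ' c = r • φ c - η c := fun c hc =>
    sup_eq hc φ' (r • φ - η) fun l hl => by rw [h1 l hl.1]; simp [η]
  refine ⟨φ', ?_, h2 [] (by simp; omega), ?_⟩
  · intro l hl
    obtain ⟨h4, h5, h6⟩ := hφ l hl
    have h7 : r • φ (bd (b l)) = φ' (bd (b l)) := by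
      rcases hl0 : l.length with _ | j
      · rw [List.length_eq_zero_iff] at hl0
        subst hl0
        simp
      · rw [h3 j (by omega) _ (bd_V hl0)]
    by_cases hlk : l.length = k
    · have h8 := hfZ l hlk
      have h9 : bd (f l) = 0 := h8.2
      rw [h1 l hlk]
      refine ⟨Submodule.sub_mem _ (Submodule.smul_of_tower_mem _ _ h4) ?_, ?_, fun g => ?_⟩
      · rw [hlk]; exact h8.1
      · rw [map_sub, h9, sub_zero, map_nsmul, h5, h7]
      · rw [h1 _ (by simpa using hlk), hfe g l hlk, h6, map_sub, map_nsmul]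
    · rw [h2 l hlk]
      refine ⟨Submodule.smul_of_tower_mem _ _ h4, ?_, fun g => ?_⟩
      · rw [map_nsmul, h5, h7]
      · rw [h2 _ (by simpa using hlk), h6, map_nsmul]
  · intro l hl
    obtain ⟨z, hz1, hz2⟩ := hηc _ (bd_V hl)
    rw [h3' _ (bd_V hl), ← hz1]
    have : r • (⟨φ (bd (b l)), hZ _ (hbl l hl)⟩ : Z) - z ∈ N := by
      rw [← Submodule.Quotient.mk_eq_zero, ← Submodule.mkQ_apply, map_sub, map_nsmul, ← ho1 l hl,
        hz2, hbd, sub_self]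
    exact this

/-- the group-invariant scale relation -/
def Eg (G : Type*) {X : Type*} [Group G] [MulAction G X] [MetricSpace X] (τ : ℝ) : X → X → Prop :=
  fun x y => ∀ u : G, dist (u • x) (u • y) < τ

lemma Eg_smul {G X : Type*} [Group G] [MulAction G X] [MetricSpace X] {τ : ℝ} (g : G) (x y : X)
    (h : Eg G τ x y) : Eg G τ (g • x) (g • y) := fun u => by
  rw [← mul_smul, ← mul_smul]; exact h _

lemma Eg_dl {G X : Type*} [Group G] [MulAction G X] [MetricSpace X] {τ : ℝ} (x y : X)
    (h : Eg G τ x y) : dl τ x y := by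
  have := h 1
  rwa [one_smul, one_smul] at this

lemma exists_Eg (G : Type*) {X : Type*} [Group G] [Finite G] [MulAction G X] [MetricSpace X]
    [CompactSpace X] [ContinuousConstSMul G X] {τ : ℝ} (hτ : 0 < τ) :
    ∃ δ > 0, ∀ x y : X, dl δ x y → Eg G τ x y := by
  have := Fintype.ofFinite G
  obtain ⟨δ, hδ, h⟩ := unif_fin (Finset.univ : Finset G) (fun g (x : X) => g • x)
    (fun g => continuous_const_smul g) τ hτ
  exact ⟨δ, hδ, fun x y hxy u => h u (Finset.mem_univ _) x y hxy⟩

lemma buildEq [NeZero r] [MetricSpace X] [CompactSpace X] [ContinuousConstSMul (Multiplicative (Fin m → ZMod r)) X] [Nonempty X]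
    (T n : ℕ) (hT : ∀ g : (Multiplicative (Fin m → ZMod r)), ∀ k < n + 2, ∀ τ' > 0, ∃ τ > 0,
      ∀ z ∈ R (dl (X := X) τ) k, bd z = 0 →
      ∃ w ∈ R (dl τ') (k + 1), bd w = T • (mp (g • ·) z - z))
    (hconn : ∀ τ' > 0, ∀ z ∈ R (dl (X := X) τ') 1, bd z = 0 →
      ∃ w ∈ R (dl τ') 2, bd w = z) : ∀ k ≤ n, ∀ τ > 0,
    ∃ φ : Ch (Multiplicative (Fin m → ZMod r)) →ₗ[ℤ] Ch X, IsEq (dl τ) (k + 2) φ ∧ φ (b []) = ((r * T) ^ k) • b [] := by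
  suffices H : ∀ k ≤ n, ∀ τ > 0,
    ∃ φ : Ch (Multiplicative (Fin m → ZMod r)) →ₗ[ℤ] Ch X, IsEq (Eg (Multiplicative (Fin m → ZMod r)) τ) (k + 2) φ ∧ φ (b []) = ((r * T) ^ k) • b [] by
    intro k hk τ hτ
    obtain ⟨φ, h1, h2⟩ := H k hk τ hτ
    exact ⟨φ, fun l hl => ⟨R_mono Eg_dl _ (h1 l hl).1, (h1 l hl).2⟩, h2⟩
  intro k
  induction k with
  | zero =>
    intro _ τ hτ
    obtain ⟨x₀⟩ := ‹Nonempty X›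
    obtain ⟨φ, h1, h2⟩ := baseEq (G := (Multiplicative (Fin m → ZMod r))) (E := Eg (Multiplicative (Fin m → ZMod r)) τ) (fun x u => by rw [dist_self]; exact hτ) x₀
    obtain ⟨δ, hδ, hE⟩ := exists_Eg (Multiplicative (Fin m → ZMod r)) (X := X) hτ
    obtain ⟨φ', h3, h4⟩ := fillStep (fun _ _ h => h) (Eg_smul (τ := τ)) h1 1 (by
      intro l hl
      obtain ⟨w, hw, hbw⟩ := hconn δ hδ (φ (bd (b l))) (by
        refine Finsupp.supported_mono ?_ (h1.mem le_rfl (bd_V hl))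
        rintro l ⟨hl, -⟩
        refine ⟨hl, ?_⟩
        obtain ⟨x, rfl⟩ := List.length_eq_one_iff.1 hl
        simp [dl, hδ]) (by rw [h1.bd le_rfl (bd_V hl), bd_bd, map_zero])
      exact ⟨w, R_mono hE _ hw, by rw [hbw, one_smul]⟩)
    exact ⟨φ', h3, by rw [h4, h2]; simp⟩
  | succ k ih =>
    intro hk τ hτ
    obtain ⟨δ, hδ, hE⟩ := exists_Eg (Multiplicative (Fin m → ZMod r)) (X := X) hτ
    choose t ht htt using fun g : (Multiplicative (Fin m → ZMod r)) => hT g (k + 2) (by omega) δ hδ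
    have := Fintype.ofFinite (Multiplicative (Fin m → ZMod r))
    obtain ⟨e, he, hle⟩ := exists_pos_le Finset.univ t ht
    obtain ⟨φ, h1, h2⟩ := ih (by omega) (min e τ) (lt_min he hτ)
    obtain ⟨φ', h3, h4, h5⟩ := obstruct (E := Eg (Multiplicative (Fin m → ZMod r)) (min e τ)) Eg_smul (by omega) h1 T
      ((R (Eg (Multiplicative (Fin m → ZMod r)) τ) (k + 3)).map bd) (by
        intro g z hz hbz
        obtain ⟨w, hw, hbw⟩ := htt g z (R_mono (fun x y h => lt_of_lt_of_le (Eg_dl x y h)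
          ((min_le_left _ _).trans (hle g (Finset.mem_univ _)))) _ hz) hbz
        exact ⟨w, R_mono hE _ hw, hbw⟩)
    obtain ⟨φ'', h6, h7⟩ := fillStep (E' := Eg (Multiplicative (Fin m → ZMod r)) τ)
      (fun x y h u => (h u).trans_le (min_le_right _ _)) Eg_smul h3 T (by
        intro l hl
        obtain ⟨w, hw, hbw⟩ := h5 l hl
        exact ⟨w, hw, hbw⟩)
    refine ⟨φ'', h6, ?_⟩
    rw [h7, h4, h2, smul_smul, smul_smul]
    congr 1
    ring

end

end

end Ch

namespace Ch

noncomputable section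

open Set

section abs

variable {G : Type*} [Group G] [Fintype G] {Q : Type*} [AddCommGroup Q]
  (D : Q →ₗ[ℤ] Q) (A e : G → Q →ₗ[ℤ] Q) (W : ℕ → Submodule ℤ Q)

lemma down
    (hDD : ∀ q, D (D q) = 0)
    (hAD : ∀ g q, A g (D q) = D (A g q)) (hAe : ∀ g h q, A g (e h q) = e (g * h) (A g q))
    (hsum : ∀ k, ∀ q ∈ W k, ∑ g, e g q = k • q)
    (hDW : ∀ k, ∀ q ∈ W (k + 1), D q ∈ W k) (heW : ∀ k g, ∀ q ∈ W k, e g q ∈ W k)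
    (Ψ : Ch G →ₗ[ℤ] Q) (n : ℕ)
    (hΨW : ∀ l : List G, l.length ≤ n + 2 → Ψ (b l) ∈ W l.length)
    (hΨD : ∀ l : List G, l.length ≤ n + 2 → D (Ψ (b l)) = Ψ (bd (b l)))
    (hΨA : ∀ l : List G, l.length ≤ n + 2 → ∀ g, Ψ (b (l.map (g * ·))) = A g (Ψ (b l)))
    (hΨ0 : ∀ l : List G, l.length = n + 2 → Ψ (b l) = 0) : ∀ j k, k + 1 + j = n + 1 → ∃ (m : ℕ) (θ : Ch G →ₗ[ℤ] Q),
    m * (k + 1).factorial = (n + 1).factorial ∧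
    ∀ l : List G, (l.length = k + 1 → θ (b l) ∈ W (k + 1) ∧
      (∀ g, θ (b (l.map (g * ·))) = A g (θ (b l))) ∧ D (θ (b l)) = m • D (Ψ (b l))) ∧
      (l.length = k + 2 → θ (bd (b l)) = 0) := by
  intro j
  induction j with
  | zero =>
    intro k hk
    obtain rfl : k = n := by omega
    refine ⟨1, Ψ, by simp, fun l => ⟨fun hl => ⟨?_, ?_, by simp⟩, fun hl => ?_⟩⟩
    · rw [← hl]; exact hΨW l (by omega)
    · exact hΨA l (by omega)
    · rw [← hΨD l (by omega), hΨ0 l hl, map_zero]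
  | succ j ih =>
    intro k hk
    obtain ⟨m, θ, hm, hθ⟩ := ih (k + 1) (by omega)
    let η : Ch G →ₗ[ℤ] Q := ∑ g, e g ∘ₗ θ ∘ₗ cone g
    have hη : ∀ c, η c = ∑ g, e g (θ (cone g c)) := fun c => by
      simp [η, LinearMap.sum_apply]
    have hηA : ∀ l : List G, l.length = k + 1 → ∀ g, η (b (l.map (g * ·))) = A g (η (b l)) := by
      intro l hl g
      rw [hη, hη, map_sum]
      symm
      refine Fintype.sum_equiv (Equiv.mulLeft g) _ _ fun h => ?_
      rw [hAe, Equiv.coe_mulLeft, cone_b, cone_b]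
      have := ((hθ (h :: l)).1 (by simp [hl])).2.1 g
      rw [← this, List.map_cons]
    have hηW : ∀ l : List G, l.length = k + 1 → η (b l) ∈ W (k + 2) := by
      intro l hl
      rw [hη]
      refine Submodule.sum_mem _ fun g _ => heW _ _ _ ?_
      rw [cone_b]
      exact ((hθ (g :: l)).1 (by simp [hl])).1
    have hηb : ∀ l : List G, l.length = k + 2 → η (bd (b l)) = (k + 2) • θ (b l) := by
      intro l hl
      rw [hη, ← hsum _ _ ((hθ l).1 hl).1]
      refine Finset.sum_congr rfl fun g _ => ?_
      have h1 := (hθ (g :: l)).2 (by simp [hl])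
      rw [bd_cons, map_sub, sub_eq_zero] at h1
      rw [h1]
    refine ⟨(k + 2) * m, ((k + 2) * m) • Ψ - D ∘ₗ η, ?_, fun l => ⟨fun hl => ⟨?_, ?_, ?_⟩,
      fun hl => ?_⟩⟩
    · rw [← hm, Nat.factorial_succ (k + 1)]; ring
    · simp only [LinearMap.sub_apply, LinearMap.smul_apply, LinearMap.comp_apply]
      refine Submodule.sub_mem _ (Submodule.smul_of_tower_mem _ _ ?_) (hDW _ _ (hηW l hl))
      rw [← hl]; exact hΨW l (by omega)
    · intro g
      simp only [LinearMap.sub_apply, LinearMap.smul_apply, LinearMap.comp_apply, map_sub,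
        map_nsmul, hηA l hl, hΨA l (by omega), hAD]
    · simp only [LinearMap.sub_apply, LinearMap.smul_apply, LinearMap.comp_apply, map_sub,
        map_nsmul, hDD, sub_zero]
    · simp only [LinearMap.sub_apply, LinearMap.smul_apply, LinearMap.comp_apply, hηb l hl,
        map_nsmul, ((hθ l).1 hl).2.2, smul_smul, hΨD l (by omega), sub_self]

lemma down_final
    (hDD : ∀ q, D (D q) = 0)
    (hAD : ∀ g q, A g (D q) = D (A g q)) (hAe : ∀ g h q, A g (e h q) = e (g * h) (A g q))
    (hsum : ∀ k, ∀ q ∈ W k, ∑ g, e g q = k • q)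
    (hDW : ∀ k, ∀ q ∈ W (k + 1), D q ∈ W k) (heW : ∀ k g, ∀ q ∈ W k, e g q ∈ W k)
    (Ψ : Ch G →ₗ[ℤ] Q) (n : ℕ)
    (hΨW : ∀ l : List G, l.length ≤ n + 2 → Ψ (b l) ∈ W l.length)
    (hΨD : ∀ l : List G, l.length ≤ n + 2 → D (Ψ (b l)) = Ψ (bd (b l)))
    (hΨA : ∀ l : List G, l.length ≤ n + 2 → ∀ g, Ψ (b (l.map (g * ·))) = A g (Ψ (b l)))
    (hΨ0 : ∀ l : List G, l.length = n + 2 → Ψ (b l) = 0)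
    (q0 : Q) (hq0 : ∀ s t : ℤ, s • q0 = t • q0 → s = t)
    (hW0 : ∀ q ∈ W 0, ∃ s : ℤ, q = s • q0) (hAq : ∀ g, A g q0 = q0) (d : ℕ)
    (hd : Ψ (b []) = d • q0) : Fintype.card G ∣ (n + 1).factorial * d := by
  obtain ⟨m, θ, hm, hθ⟩ := down D A e W hDD hAD hAe hsum hDW heW Ψ n hΨW hΨD hΨA hΨ0 n 0 (by omega)
  simp only [Nat.zero_add, Nat.factorial_one, mul_one] at hm
  obtain ⟨hW1, hA1, hD1⟩ := (hθ [1]).1 rfl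
  obtain ⟨s, hs⟩ := hW0 _ (hDW 0 _ (heW _ 1 _ hW1))
  -- sum of `e g θ [g]`
  have h1 : ∑ g : G, e g (θ (b [g])) = θ (b [1]) := by
    have h2 : ∀ g : G, θ (b [g]) = θ (b [1]) := by
      intro g
      have := (hθ [1, g]).2 rfl
      simp only [bd_cons, bd_nil, map_zero, sub_zero, map_sub, cone_b] at this
      exact sub_eq_zero.1 this
    simp only [h2]
    have := hsum 1 _ hW1
    simpa using this
  have h3 : ∀ g : G, D (e g (θ (b [g]))) = s • q0 := by
    intro g
    have := hA1 g
    simp only [List.map_cons, List.map_nil, mul_one] at this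
    rw [this]
    have h4 := hAe g 1 (θ (b [1]))
    rw [mul_one] at h4
    rw [← h4, ← hAD, hs, map_zsmul, hAq]
  have h5 := congrArg D h1
  rw [map_sum, hD1, hΨD _ (by simp)] at h5
  simp only [h3, bd_cons, bd_nil, map_zero, sub_zero, hd, Finset.sum_const, Finset.card_univ,
    smul_smul] at h5
  rw [hm] at h5
  have h6 := hq0 ((Fintype.card G : ℤ) * s) (((n + 1).factorial * d : ℕ) : ℤ) (by
    rw [natCast_zsmul, ← h5, mul_smul, natCast_zsmul])
  have : (Fintype.card G : ℤ) ∣ (((n + 1).factorial * d : ℕ) : ℤ) := ⟨s, h6.symm⟩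
  exact_mod_cast this

end abs

section wedge

variable {J : Type*}

/-- wedge generator -/
def wi (j : J) : ExteriorAlgebra ℤ (J →₀ ℤ) := ExteriorAlgebra.ι ℤ (Finsupp.single j 1)

/-- wedge product of a list -/
def wd : Ch J →ₗ[ℤ] ExteriorAlgebra ℤ (J →₀ ℤ) := ext fun l => (l.map wi).prod

@[simp] lemma wd_b (l : List J) : wd (b l) = (l.map wi).prod := by simp [wd]

lemma wd_cone (j : J) (c : Ch J) : wd (cone j c) = wi j * wd c := by
  have := hom_ext' (f := wd ∘ₗ cone j) (g := LinearMap.mulLeft ℤ (wi j) ∘ₗ wd)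
    (by intro l; simp) c
  simpa using this

lemma wd_not_nodup (l : List J) (hl : ¬ l.Nodup) : wd (b l) = 0 := by
  have h1 : (l.map wi).prod = ExteriorAlgebra.ιMulti ℤ l.length
      (fun i => Finsupp.single (l.get i) (1 : ℤ)) := by
    rw [ExteriorAlgebra.ιMulti_apply]
    congr 1
    conv_lhs => rw [← List.ofFn_get l, List.map_ofFn]
    rfl
  rw [wd_b, h1]
  refine AlternatingMap.map_eq_zero_of_not_injective _ _ fun hinj => hl ?_
  rw [List.nodup_iff_injective_get]
  intro i j hij
  exact hinj (by simp only [hij])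

/-- contraction with a functional -/
def ctr (d : Module.Dual ℤ (J →₀ ℤ)) :
    ExteriorAlgebra ℤ (J →₀ ℤ) →ₗ[ℤ] ExteriorAlgebra ℤ (J →₀ ℤ) :=
  CliffordAlgebra.contractLeft (Q := (0 : QuadraticForm ℤ (J →₀ ℤ))) d

lemma ctr_one (d : Module.Dual ℤ (J →₀ ℤ)) : ctr d 1 = 0 := CliffordAlgebra.contractLeft_one _ _

lemma ctr_wi_mul (d : Module.Dual ℤ (J →₀ ℤ)) (j : J) (w) :
    ctr d (wi j * w) = d (Finsupp.single j 1) • w - wi j * ctr d w :=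
  CliffordAlgebra.contractLeft_ι_mul _ _ _

lemma wi_mul_wi (i j : J) : wi i * wi j = - (wi j * wi i) := by
  rw [eq_neg_iff_add_eq_zero]
  exact ExteriorAlgebra.ι_add_mul_swap _ _

lemma wd_bd (c : Ch J) : wd (bd c) = ctr (Finsupp.linearCombination ℤ fun _ => (1 : ℤ)) (wd c) := by
  refine hom_ext' (f := wd ∘ₗ bd)
    (g := ctr (Finsupp.linearCombination ℤ fun _ => (1 : ℤ)) ∘ₗ wd) ?_ c
  intro l
  induction l with
  | nil => simp [ctr_one]
  | cons x l ih =>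
    simp only [LinearMap.comp_apply] at ih ⊢
    rw [bd_cons, map_sub, wd_cone, ih, ← cone_b x l, wd_cone, ctr_wi_mul]
    simp

lemma wd_mp (f : J → J) (c : Ch J) :
    wd (mp f c) = ExteriorAlgebra.map (Finsupp.lmapDomain ℤ ℤ f) (wd c) := by
  refine hom_ext' (f := wd ∘ₗ mp f)
    (g := (ExteriorAlgebra.map (Finsupp.lmapDomain ℤ ℤ f)).toLinearMap ∘ₗ wd) ?_ c
  intro l
  simp only [LinearMap.comp_apply, mp_b, wd_b, AlgHom.toLinearMap_apply, map_list_prod,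
    List.map_map]
  congr 2
  funext x
  simp [wi]

variable {G : Type*} [DecidableEq G]

/-- number of entries of type `g` -/
def cnt (γ : J → G) (g : G) (l : List J) : ℤ := (l.map fun j => if γ j = g then 1 else 0).sum

/-- counting operator -/
def cn (γ : J → G) (g : G) : Ch J →ₗ[ℤ] Ch J := ext fun l => cnt γ g l • b l

lemma cn_b (γ : J → G) (g : G) (l : List J) : cn γ g (b l) = cnt γ g l • b l := by simp [cn]

lemma wd_cn [Fintype J] [DecidableEq J] (γ : J → G) (g : G) (c : Ch J) : wd (cn γ g c) =
    ∑ j with γ j = g, wi j * ctr (Finsupp.lapply j) (wd c) := by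
  have := hom_ext' (f := wd ∘ₗ cn γ g)
    (g := ∑ j with γ j = g, LinearMap.mulLeft ℤ (wi j) ∘ₗ ctr (Finsupp.lapply j) ∘ₗ wd) (by
    intro l
    induction l with
    | nil => simp [cn_b, cnt, ctr_one]
    | cons x l ih =>
      simp only [LinearMap.comp_apply, LinearMap.sum_apply, LinearMap.mulLeft_apply, cn_b,
        map_zsmul] at ih ⊢
      rw [← cone_b x l, wd_cone]
      have h1 : ∀ j, wi j * ctr (Finsupp.lapply j) (wi x * wd (b l)) =
          (if j = x then wi x * wd (b l) else 0) + wi x * (wi j * ctr (Finsupp.lapply j) (wd (b l))) := by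
        intro j
        rw [ctr_wi_mul, mul_sub, ← mul_assoc (wi j) (wi x), wi_mul_wi j x]
        by_cases h : j = x
        · subst h; simp [mul_assoc]
        · simp [h, Ne.symm h, mul_assoc]
      simp only [h1]
      rw [Finset.sum_add_distrib, ← Finset.mul_sum, ← ih]
      simp only [cnt, List.map_cons, List.sum_cons, add_smul]
      rw [mul_smul_comm]
      congr 1
      simp [Finset.sum_ite_eq']) c
  simpa using this

lemma cnt_smul [Group G] [MulAction G J] (γ : J → G) (hγ : ∀ (g : G) j, γ (g • j) = g * γ j)
    (g h : G) (l : List J) : cnt γ (g * h) (l.map (g • ·)) = cnt γ h l := by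
  simp only [cnt, List.map_map]
  congr 2
  funext x
  simp [hγ]

lemma cnt_sum [Fintype G] (γ : J → G) (l : List J) : ∑ g, cnt γ g l = l.length := by
  induction l with
  | nil => simp [cnt]
  | cons x l ih =>
    simp only [cnt, List.map_cons, List.sum_cons, Finset.sum_add_distrib] at ih ⊢
    rw [ih]
    simp [add_comm]

end wedge

/-- The final algebraic step. -/
lemma card_dvd {G J : Type*} [Group G] [Fintype G] [Fintype J] [MulAction G J] (γ : J → G)
    (hγ : ∀ (g : G) j, γ (g • j) = g * γ j) {X : Type*} [MulAction G X] (v : X → J)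
    (hv : ∀ (g : G) x, v (g • x) = g • v x) (E : X → X → Prop) (n : ℕ)
    (hE : ∀ l ∈ SL E (n + 2), ¬ (l.map v).Nodup)
    (φ : Ch G →ₗ[ℤ] Ch X) (hφ : IsEq E (n + 2) φ) (d : ℕ) (hd : φ (b []) = d • b []) :
    Fintype.card G ∣ (n + 1).factorial * d := by
  classical
  let K : Submodule ℤ (Ch J) := LinearMap.ker wd
  have hK : ∀ c, c ∈ K ↔ wd c = 0 := fun c => Iff.rfl
  have k1 : K ≤ K.comap bd := fun c hc => by
    rw [Submodule.mem_comap, hK, wd_bd, (hK c).1 hc, map_zero]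
  have k2 : ∀ g : G, K ≤ K.comap (mp (g • ·)) := fun g c hc => by
    rw [Submodule.mem_comap, hK, wd_mp, (hK c).1 hc, map_zero]
  have k3 : ∀ g : G, K ≤ K.comap (cn γ g) := fun g c hc => by
    rw [Submodule.mem_comap, hK, wd_cn, (hK c).1 hc]; simp
  have hmk : ∀ q : Ch J ⧸ K, ∃ c, q = K.mkQ c := fun q => by
    obtain ⟨c, hc⟩ := K.mkQ_surjective q; exact ⟨c, hc.symm⟩
  refine down_final (K.mapQ K bd k1) (fun g => K.mapQ K _ (k2 g)) (fun g => K.mapQ K _ (k3 g))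
    (fun k => (sup (V univ k)).map K.mkQ) ?_ ?_ ?_ ?_ ?_ ?_ (K.mkQ ∘ₗ mp v ∘ₗ φ) n ?_ ?_ ?_ ?_
    (K.mkQ (b [])) ?_ ?_ ?_ d ?_
  · intro q
    obtain ⟨c, rfl⟩ := hmk q
    simp only [Submodule.mkQ_apply, Submodule.mapQ_apply, bd_bd, Submodule.Quotient.mk_zero]
  · intro g q
    obtain ⟨c, rfl⟩ := hmk q
    simp only [Submodule.mkQ_apply, Submodule.mapQ_apply, mp_bd]
  · intro g h q
    obtain ⟨c, rfl⟩ := hmk q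
    simp only [Submodule.mkQ_apply, Submodule.mapQ_apply]
    congr 1
    refine hom_ext' (f := mp (g • ·) ∘ₗ cn γ h) (g := cn γ (g * h) ∘ₗ mp (g • ·)) ?_ c
    intro l
    simp only [LinearMap.comp_apply, cn_b, mp_b, map_zsmul, cnt_smul γ hγ]
  · rintro k _ ⟨c, hc, rfl⟩
    simp only [Submodule.mkQ_apply, Submodule.mapQ_apply]
    simp only [← Submodule.mkQ_apply]
    rw [← map_sum, ← map_nsmul]
    congr 1
    have := sup_eq hc (∑ g, cn γ g) (k • LinearMap.id) fun l hl => by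
      simp only [LinearMap.sum_apply, cn_b, ← Finset.sum_smul, cnt_sum, hl.1]
      simp
    simpa using this
  · rintro k _ ⟨c, hc, rfl⟩
    simp only [Submodule.mkQ_apply, Submodule.mapQ_apply]
    exact ⟨bd c, sup_ind hc bd _ fun l hl => bd_V hl.1, rfl⟩
  · rintro k g _ ⟨c, hc, rfl⟩
    simp only [Submodule.mkQ_apply, Submodule.mapQ_apply]
    exact ⟨cn γ g c, sup_ind hc _ _ fun l hl => by
      rw [cn_b]; exact Submodule.smul_mem _ _ (b_mem hl), rfl⟩
  · intro l hl
    refine ⟨mp v (φ (b l)), ?_, rfl⟩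
    refine sup_ind (hφ l hl).1 _ _ fun l' hl' => ?_
    rw [mp_b]
    exact b_mem ⟨by simp [hl'.1], by simp⟩
  · intro l hl
    simp only [LinearMap.comp_apply, Submodule.mkQ_apply, Submodule.mapQ_apply]
    rw [← mp_bd, (hφ l hl).2.1]
  · intro l hl g
    simp only [LinearMap.comp_apply, Submodule.mkQ_apply, Submodule.mapQ_apply]
    rw [(hφ l hl).2.2, mp_mp, mp_mp]
    simp only [hv]
  · intro l hl
    simp only [LinearMap.comp_apply, Submodule.mkQ_apply]
    rw [Submodule.Quotient.mk_eq_zero, hK]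
    have h1 := (hφ l hl.le).1
    rw [hl] at h1
    exact sup_eq h1 (wd ∘ₗ mp v) 0 fun l' hl' => by
      rw [LinearMap.comp_apply, mp_b, wd_not_nodup _ (hE l' hl')]; rfl
  · intro s t hst
    rw [← sub_eq_zero, ← sub_smul, ← map_zsmul, Submodule.mkQ_apply,
      Submodule.Quotient.mk_eq_zero, hK, map_zsmul, wd_b] at hst
    simp only [List.map_nil, List.prod_nil] at hst
    have : algebraMap ℤ (ExteriorAlgebra ℤ (J →₀ ℤ)) (s - t) = 0 := by
      rw [Algebra.algebraMap_eq_smul_one]; exact hst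
    rw [ExteriorAlgebra.algebraMap_eq_zero_iff] at this
    omega
  · rintro _ ⟨c, hc, rfl⟩
    have := sup_ind hc LinearMap.id (Submodule.span ℤ {b []}) fun l hl => by
      rw [List.length_eq_zero_iff.1 hl.1]
      exact Submodule.mem_span_singleton_self _
    obtain ⟨s, hs⟩ := Submodule.mem_span_singleton.1 this
    refine ⟨s, ?_⟩
    rw [← map_zsmul, hs]; rfl
  · intro g
    simp only [Submodule.mkQ_apply, Submodule.mapQ_apply, mp_b, List.map_nil]
  · simp only [LinearMap.comp_apply, hd, map_nsmul, mp_b, List.map_nil]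

end

end Ch

namespace Ch

noncomputable section

open Set Metric Topology

section

lemma color (n : ℕ) (t : Fin n → ℝ) : ∃ (c : Fin (n + 1)) (m : Fin n → ℤ),
    ∀ i, (m i : ℝ) < t i - (c : ℝ) / (n + 1) ∧ t i - (c : ℝ) / (n + 1) < m i + 1 := by
  by_contra hcon
  push Not at hcon
  have h1 : ∀ c : Fin (n + 1), ∃ i, ∃ z : ℤ, t i - (c : ℝ) / (n + 1) = z := by
    intro c
    obtain ⟨i, hi⟩ := hcon c fun i => ⌊t i - (c : ℝ) / (n + 1)⌋
    refine ⟨i, ⌊t i - (c : ℝ) / (n + 1)⌋, ?_⟩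
    by_contra hne
    have := hi (lt_of_le_of_ne (Int.floor_le _) (Ne.symm hne))
    exact absurd (Int.lt_floor_add_one (t i - (c : ℝ) / (n + 1))) (not_lt.2 this)
  choose f z hz using h1
  have hinj : Function.Injective f := by
    intro c c' h
    have h2 := hz c
    have h3 := hz c'
    rw [← h] at h3
    have hn : (0 : ℝ) < n + 1 := by positivity
    have h4 : ((c' : ℕ) : ℝ) - ((c : ℕ) : ℝ) = ((z c - z c' : ℤ) : ℝ) * (n + 1) := by
      push_cast
      rw [← h2, ← h3]
      field_simp
      ring
    have h5 : ((c' : ℕ) : ℤ) - ((c : ℕ) : ℤ) = (z c - z c') * (n + 1) := by exact_mod_cast h4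
    have hc := c.2
    have hc' := c'.2
    have h6 : z c - z c' = 0 := by
      by_contra hne
      rcases lt_or_gt_of_ne hne with h | h <;> nlinarith
    rw [h6] at h5
    ext
    omega
  have := Fintype.card_le_of_injective f hinj
  simp at this

variable {G : Type*} [Group G] [Finite G] {X : Type*} [MetricSpace X] [CompactSpace X]
  [MulAction G X] [ContinuousConstSMul G X]

/-- a finite `G`-cover -/
structure IsCov (G : Type*) [Group G] {X I : Type*} [TopologicalSpace X] [MulAction G X]
    (U : I → Set X) : Prop where
  op : ∀ i, IsOpen (U i)
  disj : ∀ i (g : G) x, x ∈ U i → g • x ∈ U i → g = 1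
  cov : ∀ x, ∃ i, ∃ g : G, g • x ∈ U i

/-- order at most `n + 1` at `x` -/
def OrdAt (G : Type*) [Group G] {X I : Type*} [MulAction G X] (U : I → Set X) (n : ℕ) (x : X) :
    Prop := ∀ s : Finset I, (∀ i ∈ s, ∃ g : G, g • x ∈ U i) → s.card ≤ n + 1

lemma cov_local {n : ℕ} {I : Type*} (e : OpenPartialHomeomorph X (Fin n → ℝ)) {N A : Set X}
    (hN : IsOpen N) (hNe : N ⊆ e.source) (hNd : ∀ (g : G) x, x ∈ N → g • x ∈ N → g = 1)
    (hA : IsCompact A) (hAN : A ⊆ N) (U : I → Set X) (hU : IsCov G U) :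
    ∃ V : I → Set X, IsCov G V ∧ (∀ i, V i ⊆ U i) ∧ ∀ x ∈ A, OrdAt G V n x := by
  classical
  rcases isEmpty_or_nonempty X with hX | ⟨⟨x₀⟩⟩
  · exact ⟨U, hU, fun _ => subset_rfl, fun x => isEmptyElim x⟩
  have hI : Nonempty I := ⟨(hU.cov x₀).choose⟩
  -- Lebesgue number
  obtain ⟨δ, hδ, hL⟩ := lebesgue_number_lemma_of_metric (s := e '' A)
    (c := fun p : I × G => e '' (N ∩ {x | p.2 • x ∈ U p.1}))
    (hA.image_of_continuousOn (e.continuousOn.mono (hAN.trans hNe)))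
    (fun p => e.isOpen_image_of_subset_source
      (hN.inter ((hU.op p.1).preimage (continuous_const_smul p.2))) (inter_subset_left.trans hNe))
    (by
      rintro _ ⟨x, hx, rfl⟩
      obtain ⟨i, g, h⟩ := hU.cov x
      exact mem_iUnion.2 ⟨(i, g), x, ⟨hAN hx, h⟩, rfl⟩)
  let s : ℝ := δ / 2
  have hs : 0 < s := half_pos hδ
  let C : Fin (n + 1) × (Fin n → ℤ) → Set (Fin n → ℝ) := fun j =>
    {y | ∀ i, (j.2 i : ℝ) < y i / s - (j.1 : ℝ) / (n + 1) ∧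
      y i / s - (j.1 : ℝ) / (n + 1) < j.2 i + 1}
  have hCo : ∀ j, IsOpen (C j) := by
    intro j
    have : C j = ⋂ i, ({y | (j.2 i : ℝ) < y i / s - (j.1 : ℝ) / (n + 1)} ∩
        {y | y i / s - (j.1 : ℝ) / (n + 1) < j.2 i + 1}) := by
      ext y; simp [C]
    rw [this]
    refine isOpen_iInter_of_finite fun i => IsOpen.inter ?_ ?_
    · exact isOpen_lt continuous_const (by fun_prop)
    · exact isOpen_lt (by fun_prop) continuous_const
  let Q : Fin (n + 1) × (Fin n → ℤ) → Set X := fun j => N ∩ e ⁻¹' (C j)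
  have hQo : ∀ j, IsOpen (Q j) := fun j =>
    (e.continuousOn.mono hNe).isOpen_inter_preimage hN (hCo j)
  have hQ : ∀ j, (A ∩ Q j).Nonempty → ∃ p : I × G, ∀ x ∈ Q j, p.2 • x ∈ U p.1 := by
    rintro j ⟨a, ha, haN, haC⟩
    obtain ⟨p, hp⟩ := hL (e a) ⟨a, ha, rfl⟩
    refine ⟨p, fun x hx => ?_⟩
    have hb : e x ∈ ball (e a) δ := by
      rw [mem_ball, dist_pi_lt_iff hδ]
      intro i
      have h1 := haC i
      have h2 := hx.2 i
      have h3 : |e x i / s - e a i / s| < 1 := by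
        rw [abs_lt]; constructor <;> linarith
      rw [← sub_div, abs_div, abs_of_pos hs, div_lt_one hs] at h3
      rw [Real.dist_eq]
      exact h3.trans (half_lt_self hδ)
    obtain ⟨x', ⟨hx'N, hx'U⟩, hxx⟩ := hp hb
    have : x' = x := e.injOn (hNe hx'N) (hNe hx.1) hxx
    rwa [← this]
  choose! p hp using hQ
  let GA : Set X := ⋃ g : G, (fun x => g • x) '' A
  have hGA : IsClosed GA := isClosed_iUnion_of_finite fun g =>
    (hA.image (continuous_const_smul g)).isClosed
  have hGA1 : ∀ (g : G) x, g • x ∈ GA → ∃ h : G, h • x ∈ A := by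
    intro g x h
    obtain ⟨h, a, ha, hax⟩ := mem_iUnion.1 h
    refine ⟨h⁻¹ * g, ?_⟩
    rw [mul_smul, ← hax]
    simpa using ha
  have hGA2 : ∀ (g : G), ∀ x ∈ A, g • x ∈ GA := fun g x hx => mem_iUnion.2 ⟨g, x, hx, rfl⟩
  let V : I → Set X := fun i =>
    (⋃ j, ⋃ (_ : (A ∩ Q j).Nonempty ∧ (p j).1 = i), (fun x => (p j).2 • x) '' Q j) ∪ (U i \ GA)
  have hVU : ∀ i, V i ⊆ U i := by
    rintro i x (hx | hx)
    · simp only [mem_iUnion] at hx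
      obtain ⟨j, ⟨hj, rfl⟩, y, hy, rfl⟩ := hx
      exact hp j hj y hy
    · exact hx.1
  refine ⟨V, ⟨?_, ?_, ?_⟩, hVU, ?_⟩
  · intro i
    refine IsOpen.union ?_ ((hU.op i).sdiff hGA)
    refine isOpen_iUnion fun j => isOpen_iUnion fun _ => ?_
    exact (isOpenMap_smul (p j).2) _ (hQo j)
  · intro i g x h1 h2
    exact hU.disj i g x (hVU i h1) (hVU i h2)
  · intro x
    by_cases hx : ∃ h : G, h • x ∈ A
    · obtain ⟨h, hx⟩ := hx
      obtain ⟨c, m, hcm⟩ := color n fun i => e (h • x) i / s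
      have hQx : h • x ∈ Q (c, m) := ⟨hAN hx, hcm⟩
      refine ⟨(p (c, m)).1, (p (c, m)).2 * h, Or.inl ?_⟩
      simp only [mem_iUnion]
      exact ⟨(c, m), ⟨⟨h • x, hx, hQx⟩, rfl⟩, h • x, hQx, (mul_smul _ _ _).symm⟩
    · obtain ⟨i, g, h⟩ := hU.cov x
      exact ⟨i, g, Or.inr ⟨h, fun h' => hx (hGA1 g x h')⟩⟩
  · intro x hx S hS
    have key : ∀ i ∈ S, ∃ j, x ∈ Q j ∧ (p j).1 = i := by
      intro i hi
      obtain ⟨g, h⟩ := hS i hi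
      rcases h with h | h
      · simp only [mem_iUnion] at h
        obtain ⟨j, ⟨hj, hji⟩, y, hy, hyx⟩ := h
        refine ⟨j, ?_, hji⟩
        simp only at hyx
        have h1 : y = ((p j).2⁻¹ * g) • x := by
          rw [mul_smul, ← hyx, inv_smul_smul]
        have h2 := hNd ((p j).2⁻¹ * g) x (hAN hx) (by rw [← h1]; exact hy.1)
        rw [h2, one_smul] at h1
        rwa [← h1]
      · exact absurd (hGA2 g x hx) h.2
    let F : Fin (n + 1) → I := fun c => (p (c, fun i => ⌊e x i / s - (c : ℝ) / (n + 1)⌋)).1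
    have hsub : S ⊆ Finset.univ.image F := by
      intro i hi
      obtain ⟨j, hj, rfl⟩ := key i hi
      refine Finset.mem_image.2 ⟨j.1, Finset.mem_univ _, ?_⟩
      have : (fun i => ⌊e x i / s - (j.1 : ℝ) / (n + 1)⌋) = j.2 := by
        funext i
        rw [Int.floor_eq_iff]
        exact ⟨(hj.2 i).1.le, (hj.2 i).2⟩
      simp only [F, this]
    calc S.card ≤ _ := Finset.card_le_card hsub
      _ ≤ _ := Finset.card_image_le
      _ = n + 1 := by simp

lemma exists_cov {n : ℕ} (hfree : ∀ (g : G) (x : X), g • x = x → g = 1)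
    (hch : ∀ x : X, ∃ e : OpenPartialHomeomorph X (Fin n → ℝ), x ∈ e.source) :
    ∃ (t : Finset X) (U : t → Set X), IsCov G U ∧ ∀ x, OrdAt G U n x := by
  classical
  have := Fintype.ofFinite G
  -- displacement bound
  have hdisp : ∃ ε > 0, ∀ g : G, g ≠ 1 → ∀ x : X, ε ≤ dist (g • x) x := by
    have : ∀ g : G, ∃ ε > 0, g ≠ 1 → ∀ x : X, ε ≤ dist (g • x) x := by
      intro g
      by_cases hg : g = 1
      · exact ⟨1, one_pos, fun h => absurd hg h⟩
      rcases isEmpty_or_nonempty X with hX | hX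
      · exact ⟨1, one_pos, fun _ x => isEmptyElim x⟩
      have hc : Continuous fun x : X => dist (g • x) x :=
        (continuous_const_smul g).dist continuous_id
      obtain ⟨x, -, hx⟩ := isCompact_univ.exists_isMinOn univ_nonempty hc.continuousOn
      refine ⟨dist (g • x) x, dist_pos.2 fun h => hg (hfree g x h), fun _ y => hx (mem_univ y)⟩
    choose ε hε h using this
    obtain ⟨ε', hε', hle⟩ := exists_pos_le Finset.univ ε hε
    exact ⟨ε', hε', fun g hg x => (hle g (Finset.mem_univ _)).trans (h g hg x)⟩
  obtain ⟨ε, hε, hdisp⟩ := hdisp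
  choose e he using hch
  let N : X → Set X := fun p => ball p (ε / 2) ∩ (e p).source
  have hNo : ∀ p, IsOpen (N p) := fun p => isOpen_ball.inter (e p).open_source
  have hNp : ∀ p, p ∈ N p := fun p => ⟨mem_ball_self (half_pos hε), he p⟩
  have hNd : ∀ p (g : G) x, x ∈ N p → g • x ∈ N p → g = 1 := by
    intro p g x h1 h2
    by_contra hg
    have h3 := hdisp g hg x
    have h4 := mem_ball.1 h1.1
    have h5 := mem_ball.1 h2.1
    have h6 := dist_triangle_right (g • x) x p
    linarith
  choose A hAc hpA hAN using fun p => exists_compact_subset (hNo p) (hNp p)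
  obtain ⟨t, ht⟩ := isCompact_univ.elim_finite_subcover (fun p => interior (A p))
    (fun p => isOpen_interior) (fun p _ => mem_iUnion.2 ⟨p, hpA p⟩)
  refine ⟨t, ?_⟩
  suffices H : ∀ s : Finset X, ∃ U : t → Set X, IsCov G U ∧ ∀ p ∈ s, ∀ x ∈ A p, OrdAt G U n x by
    obtain ⟨U, h1, h2⟩ := H t
    refine ⟨U, h1, fun x => ?_⟩
    have := ht (mem_univ x)
    simp only [mem_iUnion] at this
    obtain ⟨p, hp, hx⟩ := this
    exact h2 p hp x (interior_subset hx)
  intro s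
  induction s using Finset.induction_on with
  | empty =>
    refine ⟨fun p => N p, ⟨fun i => hNo i, fun i => hNd i, fun x => ?_⟩, by simp⟩
    have := ht (mem_univ x)
    simp only [mem_iUnion] at this
    obtain ⟨p, hp, hx⟩ := this
    exact ⟨⟨p, hp⟩, 1, by rw [one_smul]; exact hAN p (interior_subset hx)⟩
  | insert p s _ ih =>
    obtain ⟨U, h1, h2⟩ := ih
    obtain ⟨V, h3, h4, h5⟩ := cov_local (e p) (hNo p) inter_subset_right (hNd p) (hAc p) (hAN p) U h1
    refine ⟨V, h3, fun q hq x hx => ?_⟩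
    rcases Finset.mem_insert.1 hq with rfl | hq
    · exact h5 x hx
    · intro S hS
      refine h2 q hq x hx S fun i hi => ?_
      obtain ⟨g, hg⟩ := hS i hi
      exact ⟨g, h4 i hg⟩

lemma cover {n : ℕ} (hfree : ∀ (g : G) (x : X), g • x = x → g = 1)
    (hch : ∀ x : X, ∃ e : OpenPartialHomeomorph X (Fin n → ℝ), x ∈ e.source) :
    ∃ (t : Finset X) (v : X → t × G), (∀ (g : G) x, v (g • x) = ((v x).1, g * (v x).2)) ∧
      ∃ τ > 0, ∀ l ∈ SL (dl τ) (n + 2), ¬ (l.map v).Nodup := by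
  classical
  obtain ⟨t, U, hU, hord⟩ := exists_cov (n := n) hfree hch
  obtain ⟨lam, hlam, hL⟩ := lebesgue_number_lemma_of_metric (s := (univ : Set X))
    (c := fun p : t × G => {x | p.2 • x ∈ U p.1}) isCompact_univ
    (fun p => (hU.op p.1).preimage (continuous_const_smul p.2)) (by
      intro x _
      obtain ⟨i, g, h⟩ := hU.cov x
      exact mem_iUnion.2 ⟨(i, g), h⟩)
  obtain ⟨τ, hτ, hE⟩ := exists_Eg G (X := X) hlam
  have hex : ∀ x : X, ∃ p : t × G, ∀ y, Eg G lam x y → p.2⁻¹ • y ∈ U p.1 := by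
    intro x
    obtain ⟨p, hp⟩ := hL x (mem_univ x)
    refine ⟨(p.1, p.2⁻¹), fun y hy => ?_⟩
    have : dist x y < lam := Eg_dl x y hy
    have := hp (mem_ball'.2 this)
    simpa using this
  choose f hf using hex
  -- representatives
  let rep : X → X := fun x => (Quotient.mk (MulAction.orbitRel G X) x).out
  have hrep : ∀ x, ∃ g : G, g • rep x = x := by
    intro x
    have h : (MulAction.orbitRel G X).r (rep x) x := Quotient.mk_out (s := MulAction.orbitRel G X) x
    have h2 : x ∈ MulAction.orbit G (rep x) := by
      rw [MulAction.mem_orbit_symm]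
      exact h
    exact h2
  have hrep2 : ∀ (g : G) x, rep (g • x) = rep x := by
    intro g x
    simp only [rep]
    congr 1
    exact Quotient.sound (s := MulAction.orbitRel G X) ⟨g, rfl⟩
  choose c hc using hrep
  have hc2 : ∀ (g : G) x, c (g • x) = g * c x := by
    intro g x
    have h1 := hc (g • x)
    rw [hrep2] at h1
    have h2 : ((g * c x)⁻¹ * c (g • x)) • rep x = rep x := by
      rw [mul_smul, h1, mul_inv_rev, mul_smul, inv_smul_smul, inv_smul_eq_iff, hc x]
    exact (inv_mul_eq_one.1 (hfree _ _ h2)).symm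
  let v : X → t × G := fun x => ((f (rep x)).1, c x * (f (rep x)).2)
  have hv : ∀ x y, Eg G lam x y → (v x).2⁻¹ • y ∈ U (v x).1 := by
    intro x y h
    have := hf (rep x) ((c x)⁻¹ • y) (by
      have h1 := Eg_smul (c x)⁻¹ x y h
      rwa [← eq_inv_smul_iff.2 (hc x)] at h1)
    simpa [v, mul_smul] using this
  refine ⟨t, v, fun g x => ?_, τ, hτ, ?_⟩
  · simp only [v, hrep2, hc2, mul_assoc]
  · rintro l ⟨hl, hlτ⟩ hnd
    obtain ⟨x, hx⟩ : ∃ x, x ∈ l := List.exists_mem_of_length_pos (by omega)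
    have h1 : ∀ y ∈ l, (v y).2⁻¹ • x ∈ U (v y).1 := fun y hy => hv y x (hE _ _ (hlτ y hy x hx))
    have h2 : ∀ y ∈ l, ∀ y' ∈ l, (v y).1 = (v y').1 → v y = v y' := by
      intro y hy y' hy' h
      refine Prod.ext h ?_
      have h3 := h1 y hy
      have h4 := h1 y' hy'
      rw [← h] at h4
      have h5 := hU.disj _ ((v y').2⁻¹ * (v y).2) _ h3 (by
        rw [mul_smul, smul_inv_smul]; exact h4)
      exact (inv_mul_eq_one.1 h5).symm
    have h3 : ((l.map v).map Prod.fst).Nodup := by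
      refine List.Nodup.map_on ?_ hnd
      simp only [List.mem_map]
      rintro _ ⟨y, hy, rfl⟩ _ ⟨y', hy', rfl⟩ h
      exact h2 y hy y' hy' h
    have h4 := hord x (((l.map v).map Prod.fst).toFinset) (by
      intro i hi
      simp only [List.mem_toFinset, List.mem_map] at hi
      obtain ⟨_, ⟨y, hy, rfl⟩, rfl⟩ := hi
      exact ⟨_, h1 y hy⟩)
    rw [List.toFinset_card_of_nodup h3] at h4
    simp at h4
    omega

end

end

end Ch

namespace Ch

noncomputable section

open Set Metric Topology

lemma conn_fill {X : Type*} [MetricSpace X] [ConnectedSpace X] (τ : ℝ) (hτ : 0 < τ) :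
    ∀ z ∈ R (dl (X := X) τ) 1, bd z = 0 → ∃ w ∈ R (dl τ) 2, bd w = z := by
  let B : Submodule ℤ (Ch X) := (R (dl (X := X) τ) 2).map bd
  have h1 : ∀ x y : X, dist x y < τ → b [y] - b [x] ∈ B := by
    intro x y h
    refine ⟨b [x, y], b_mem ⟨rfl, ?_⟩, by simp⟩
    simp [dl, hτ, h, dist_comm y x]
  obtain ⟨x₀⟩ : Nonempty X := inferInstance
  let S : Set X := {x | b [x] - b [x₀] ∈ B}
  have hS : S = univ := by
    refine IsClopen.eq_univ ⟨⟨?_⟩, ?_⟩ ⟨x₀, ?_⟩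
    · rw [Metric.isOpen_iff]
      intro x hx
      refine ⟨τ, hτ, fun y hy hyS => hx ?_⟩
      have := B.add_mem (h1 y x hy) hyS
      change _ ∈ B
      simpa using this
    · rw [Metric.isOpen_iff]
      intro x hx
      refine ⟨τ, hτ, fun y hy => ?_⟩
      have := B.add_mem (h1 x y (mem_ball'.1 hy)) hx
      change _ ∈ B
      simpa using this
    · change _ ∈ B
      simp
  intro z hz hbz
  have := sup_ind hz (LinearMap.id - cone x₀ ∘ₗ bd) B (by
    rintro l ⟨hl, -⟩
    obtain ⟨x, rfl⟩ := List.length_eq_one_iff.1 hl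
    have hx : x ∈ S := hS ▸ mem_univ x
    have : b [x] - b [x₀] ∈ B := hx
    simpa using this)
  simp only [LinearMap.sub_apply, LinearMap.comp_apply, hbz, map_zero, sub_zero,
    LinearMap.id_apply] at this
  exact this

lemma lcon_of_charts {X : Type*} [MetricSpace X] {n : ℕ}
    (hch : ∀ x : X, ∃ e : OpenPartialHomeomorph X (Fin n → ℝ), x ∈ e.source) : LCon X := by
  intro p ε hε
  obtain ⟨e, he⟩ := hch p
  have ho : IsOpen (e '' (ball p ε ∩ e.source)) :=
    e.isOpen_image_of_subset_source (isOpen_ball.inter e.open_source) inter_subset_right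
  obtain ⟨δ, hδ, hb⟩ := Metric.nhds_basis_closedBall.mem_iff.1
    (ho.mem_nhds ⟨p, ⟨mem_ball_self hε, he⟩, rfl⟩)
  have hbt : closedBall (e p) δ ⊆ e.target := by
    intro y hy
    obtain ⟨x, hx, rfl⟩ := hb hy
    exact e.map_source hx.2
  have hK : ∀ x ∈ e.symm '' closedBall (e p) δ, x ∈ e.source ∧ e x ∈ closedBall (e p) δ := by
    rintro _ ⟨y, hy, rfl⟩
    refine ⟨e.map_target (hbt hy), ?_⟩
    rwa [e.right_inv (hbt hy)]
  have hline : ∀ x ∈ e.symm '' closedBall (e p) δ, ∀ t ∈ Icc (0:ℝ) 1,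
      (1 - t) • e x + t • e p ∈ closedBall (e p) δ := by
    intro x hx t ht
    exact (convex_closedBall (e p) δ) (hK x hx).2 (mem_closedBall_self hδ.le)
      (by linarith [ht.2]) ht.1 (by ring)
  refine ⟨e.symm '' closedBall (e p) δ, ?_, ?_, ?_,
    fun q => e.symm ((1 - q.2) • e q.1 + q.2 • e p), ?_, ?_, ?_, p, ?_, ?_⟩
  · have := e.continuousAt he (closedBall_mem_nhds (e p) hδ)
    filter_upwards [this, e.open_source.mem_nhds he] with x hx hxs
    exact ⟨e x, hx, e.left_inv hxs⟩
  · exact (isCompact_closedBall _ _).image_of_continuousOn (e.continuousOn_symm.mono hbt)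
  · rintro _ ⟨y, hy, rfl⟩
    obtain ⟨x, hx, rfl⟩ := hb hy
    rw [e.left_inv hx.2]
    exact hx.1
  · refine e.continuousOn_symm.comp ?_ ?_
    · have h1 : ContinuousOn (fun q : X × ℝ => e q.1)
          ((e.symm '' closedBall (e p) δ) ×ˢ Icc (0:ℝ) 1) :=
        e.continuousOn.comp continuousOn_fst fun q hq => (hK _ hq.1).1
      have h2 : ContinuousOn (fun q : X × ℝ => q.2)
          ((e.symm '' closedBall (e p) δ) ×ˢ Icc (0:ℝ) 1) := continuousOn_snd
      exact ((continuousOn_const.sub h2).smul h1).add (h2.smul continuousOn_const)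
    · intro q hq
      exact hbt (hline _ hq.1 _ hq.2)
  · intro x hx t ht
    exact ⟨_, hline x hx t ht, rfl⟩
  · intro x hx
    simp [e.left_inv (hK x hx).1]
  · exact ⟨e p, mem_closedBall_self hδ.le, e.left_inv he⟩
  · intro x hx
    simp [e.left_inv he]

set_option synthInstance.maxHeartbeats 400000 in
set_option maxHeartbeats 1000000 in
lemma core {n r : ℕ} [NeZero r] {X : Type*} [MetricSpace X] [CompactSpace X] [ConnectedSpace X]
    [MulAction (Multiplicative (Fin (n + 1) → ZMod r)) X]
    [ContinuousConstSMul (Multiplicative (Fin (n + 1) → ZMod r)) X]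
    (hch : ∀ x : X, ∃ e : OpenPartialHomeomorph X (Fin n → ℝ), x ∈ e.source)
    (hfree : ∀ (g : Multiplicative (Fin (n + 1) → ZMod r)) (x : X), g • x = x → g = 1)
    (T : ℕ) (hTpos : 0 < T)
    (hT : ∀ g : Multiplicative (Fin (n + 1) → ZMod r), ∀ k < n + 2, ∀ τ' > 0, ∃ τ > 0,
      ∀ z ∈ R (dl (X := X) τ) k, bd z = 0 →
      ∃ w ∈ R (dl τ') (k + 1), bd w = T • (mp (g • ·) z - z)) :
    r ≤ (n + 1).factorial * T ^ n := by
  obtain ⟨t, v, hv, τ, hτ, hnd⟩ := cover (n := n) hfree hch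
  obtain ⟨φ, hφ, hd⟩ := buildEq T n hT (fun τ' hτ' => conn_fill τ' hτ') n le_rfl τ hτ
  let _ : MulAction (Multiplicative (Fin (n + 1) → ZMod r))
      (t × Multiplicative (Fin (n + 1) → ZMod r)) :=
    { smul := fun g p => (p.1, g * p.2)
      one_smul := fun p => Prod.ext rfl (one_mul _)
      mul_smul := fun g h p => Prod.ext rfl (mul_assoc _ _ _) }
  have := Fintype.ofFinite (Multiplicative (Fin (n + 1) → ZMod r))
  have h := card_dvd (G := Multiplicative (Fin (n + 1) → ZMod r))
    (fun p : t × Multiplicative (Fin (n + 1) → ZMod r) => p.2) (fun g p => rfl) v hv (dl τ) n hnd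
    φ hφ _ hd
  have hcard : Fintype.card (Multiplicative (Fin (n + 1) → ZMod r)) = r ^ (n + 1) := by
    rw [← Nat.card_eq_fintype_card]
    rw [Nat.card_congr (Multiplicative.toAdd), Nat.card_pi]
    simp
  rw [hcard, mul_pow, pow_succ, mul_left_comm] at h
  have h2 := Nat.dvd_of_mul_dvd_mul_left (pow_pos (NeZero.pos r) n) h
  exact Nat.le_of_dvd (by positivity) h2

set_option synthInstance.maxHeartbeats 400000 in
set_option maxHeartbeats 1000000 in
lemma metric_main {n : ℕ} {X : Type*} [MetricSpace X] [CompactSpace X] [ConnectedSpace X]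
    (hch : ∀ x : X, ∃ e : OpenPartialHomeomorph X (Fin n → ℝ), x ∈ e.source) :
    ∃ R : ℕ, ∀ r : ℕ, R ≤ r →
      ∀ ρ : Multiplicative (Fin (n + 1) → ZMod r) →* (X ≃ₜ X),
        ¬ (∀ (g : Multiplicative (Fin (n + 1) → ZMod r)) (x : X), ρ g x = x → g = 1) := by
  obtain ⟨c, hc, T, hT, hb⟩ := top_bound (lcon_of_charts hch) (n + 2)
  refine ⟨c * ((n + 1).factorial * T ^ n) + 1, fun r hr ρ hfree => ?_⟩
  have hr0 : 0 < r := by omega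
  have hρm : ∀ g h x, ρ (g * h) x = ρ g (ρ h x) := fun g h x => by rw [map_mul]; rfl
  have hρ1 : ∀ x, ρ 1 x = x := fun x => by rw [map_one]; rfl
  have hρp : ∀ g (k : ℕ) x, ρ (g ^ k) x = (ρ g)^[k] x := by
    intro g k
    induction k with
    | zero => intro x; rw [pow_zero, hρ1]; rfl
    | succ k ih => intro x; rw [pow_succ, hρm, ih]; rfl
  let r' := r / Nat.gcd r c
  have hg0 : 0 < Nat.gcd r c := Nat.gcd_pos_of_pos_left _ hr0
  have hr'0 : 0 < r' := Nat.div_pos (Nat.le_of_dvd hr0 (Nat.gcd_dvd_left _ _)) hg0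
  have : NeZero r' := ⟨hr'0.ne'⟩
  have hrr' : r' * Nat.gcd r c = r := Nat.div_mul_cancel (Nat.gcd_dvd_left _ _)
  have hdvd : r ∣ r' * c := by
    obtain ⟨u, hu⟩ := Nat.gcd_dvd_right r c
    refine ⟨u, ?_⟩
    calc r' * c = r' * (Nat.gcd r c * u) := by rw [← hu]
      _ = r * u := by rw [← mul_assoc, hrr']
  let j : ZMod r' →+ ZMod r := ZMod.lift r' ⟨zmultiplesHom (ZMod r) (c : ZMod r), by
    simp only [zmultiplesHom_apply, natCast_zsmul, nsmul_eq_mul]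
    rw [← Nat.cast_mul, ZMod.natCast_eq_zero_iff]
    exact hdvd⟩
  have hj : ∀ m : ℤ, j (m : ZMod r') = m • (c : ZMod r) := fun m => by
    simp only [j, ZMod.lift_coe, zmultiplesHom_apply]
  have hjinj : ∀ x, j x = 0 → x = 0 := by
    intro x hx
    obtain ⟨m, rfl⟩ := ZMod.intCast_surjective x
    rw [hj, zsmul_eq_mul] at hx
    have h1 : ((m * c : ℤ) : ZMod r) = 0 := by push_cast; exact hx
    rw [ZMod.intCast_zmod_eq_zero_iff_dvd] at h1
    rw [ZMod.intCast_zmod_eq_zero_iff_dvd]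
    have hcop : Nat.Coprime r' (c / Nat.gcd r c) := Nat.coprime_div_gcd_div_gcd hg0
    have hcc : c / Nat.gcd r c * Nat.gcd r c = c := Nat.div_mul_cancel (Nat.gcd_dvd_right _ _)
    have h2 : (r' : ℤ) * (Nat.gcd r c : ℤ) ∣ m * ((c / Nat.gcd r c : ℕ) : ℤ) * (Nat.gcd r c : ℤ) := by
      rw [mul_assoc, ← Nat.cast_mul, ← Nat.cast_mul, hrr', hcc]
      exact h1
    have h3 := Int.dvd_of_mul_dvd_mul_right (by exact_mod_cast hg0.ne') h2
    exact (Nat.isCoprime_iff_coprime.2 hcop).dvd_of_dvd_mul_right h3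
  have hjc : ∀ x, ∃ y, j x = c • y := by
    intro x
    obtain ⟨m, rfl⟩ := ZMod.intCast_surjective x
    refine ⟨m, ?_⟩
    rw [hj, zsmul_eq_mul, nsmul_eq_mul, mul_comm]
  let Jf : Multiplicative (Fin (n + 1) → ZMod r') →* Multiplicative (Fin (n + 1) → ZMod r) :=
    AddMonoidHom.toMultiplicative
      { toFun := fun f i => j (f i)
        map_zero' := by funext i; simp
        map_add' := by intro f g; funext i; simp }
  have hJa : ∀ g i, (Jf g).toAdd i = j (g.toAdd i) := fun g i => rfl
  have hJinj : ∀ g, Jf g = 1 → g = 1 := by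
    intro g hg
    apply Multiplicative.toAdd.injective
    funext i
    apply hjinj
    rw [← hJa, hg]
    rfl
  have hJc : ∀ g, ∃ h, Jf g = h ^ c := by
    intro g
    choose y hy using fun i => hjc (g.toAdd i)
    refine ⟨Multiplicative.ofAdd y, ?_⟩
    apply Multiplicative.toAdd.injective
    funext i
    rw [hJa, hy]
    rfl
  let _ : MulAction (Multiplicative (Fin (n + 1) → ZMod r')) X :=
    { smul := fun g x => ρ (Jf g) x
      one_smul := fun x => by change ρ (Jf 1) x = x; rw [map_one, hρ1]
      mul_smul := fun g h x => by
        change ρ (Jf (g * h)) x = ρ (Jf g) (ρ (Jf h) x)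
        rw [map_mul, hρm] }
  have hsm : ∀ (g : Multiplicative (Fin (n + 1) → ZMod r')) (x : X), g • x = ρ (Jf g) x :=
    fun g x => rfl
  have : ContinuousConstSMul (Multiplicative (Fin (n + 1) → ZMod r')) X :=
    ⟨fun g => (ρ (Jf g)).continuous⟩
  have key := core (n := n) (r := r') (X := X) hch (fun g x h => hJinj g (hfree _ x h)) T hT (by
    intro g k hk τ' hτ'
    obtain ⟨h, hh⟩ := hJc g
    have h1 : (fun x : X => g • x) = (ρ h)^[c] := by
      funext x
      rw [hsm, hh, hρp]
    rw [h1]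
    refine hb (ρ h) (ρ h).continuous r hr0 (fun x => ?_) k hk τ' hτ'
    rw [← hρp]
    have : h ^ r = 1 := by
      apply Multiplicative.toAdd.injective
      funext i
      change r • (h.toAdd i) = 0
      simp
    rw [this, hρ1])
  have h1 : r ≤ c * r' := by
    rw [mul_comm]
    exact Nat.le_of_dvd (Nat.mul_pos hr'0 hc) hdvd
  have h2 := Nat.mul_le_mul_left c key
  omega

end

end Ch

/-- Let `X` be a closed connected topological `n`-manifold. There is an integer `R` such that
for every `r ≥ R` there is no free continuous action of `(ℤ/rℤ)^(n+1)` on `X`; that is, the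
discrete degree of free symmetry of `X` is at most `n`. -/
theorem free_discsym_le_dim {n : ℕ} (X : Type*) [TopologicalSpace X] [T2Space X]
    [ChartedSpace (EuclideanSpace ℝ (Fin n)) X] [CompactSpace X] [ConnectedSpace X] :
    ∃ R : ℕ, ∀ r : ℕ, R ≤ r →
      ∀ ρ : Multiplicative (Fin (n + 1) → ZMod r) →* (X ≃ₜ X),
        ¬ (∀ (g : Multiplicative (Fin (n + 1) → ZMod r)) (x : X), ρ g x = x → g = 1) := by
  have hch : ∀ x : X, ∃ e : OpenPartialHomeomorph X (Fin n → ℝ), x ∈ e.source := fun x =>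
    ⟨(chartAt (EuclideanSpace ℝ (Fin n)) x).transHomeomorph
      (EuclideanSpace.equiv (Fin n) ℝ).toHomeomorph, mem_chart_source _ x⟩
  have h2 : SecondCountableTopology X :=
    ChartedSpace.secondCountable_of_sigmaCompact (EuclideanSpace ℝ (Fin n)) X
  have h3 : TopologicalSpace.MetrizableSpace X := inferInstance
  rename_i t _ _ _ _
  obtain ⟨m, hm⟩ : ∃ m : MetricSpace X,
      m.toPseudoMetricSpace.toUniformSpace.toTopologicalSpace = t :=
    ⟨TopologicalSpace.metrizableSpaceMetric X, rfl⟩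
  subst hm
  exact Ch.metric_main hch
end

section
/- Let B = ℤ[z₁^{±1}, …, z_b^{±1}] be the Laurent polynomial ring in b variables over ℤ (equivalently, the group algebra ℤ[ℤ^b]), and let M be a finitely generated B-module. Suppose there exists a nonzero natural number δ such that for every j ∈ {1, …, b} and every natural number R there exist an integer r ≥ R and a B-module endomorphism w of M with w^r equal to scalar multiplication by z_j^δ on M. Then M is finitely generated as a ℤ-module. -/
open TensorProduct WithZero

lemma ord_aux {C K R F : Type*} [CommRing C] [IsDomain C] [Field K] [Algebra C K]
    [IsFractionRing C K] [CommRing R] [IsDomain R] [IsNoetherianRing R] [Ring.KrullDimLE 1 R]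
    [Field F] [Algebra R F] [IsFractionRing R F] (i : C →+* R) (hinjR : Function.Injective i)
    (x : C) (hx0 : x ≠ 0) (h2 : ¬ IsUnit (i x)) :
    ∃ v : K →*₀ ℤᵐ⁰, v (algebraMap C K x) ≠ 1 := by
  let f : C →+* F := (algebraMap R F).comp i
  have hf : Function.Injective f := (IsFractionRing.injective R F).comp hinjR
  refine ⟨(Ring.ordFrac R (K := F)).comp
    (IsFractionRing.lift (K := K) hf : K →+* F).toMonoidWithZeroHom, ?_⟩
  have h1 : i x ≠ 0 := by
    intro h0
    exact hx0 (hinjR (by simpa using h0))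
  have h3 : (Ring.ord R (i x)) ≠ 0 := by
    rw [Ring.ord, Ne, Module.length_eq_zero_iff, Submodule.Quotient.subsingleton_iff]
    intro h
    exact h2 (Ideal.span_singleton_eq_top.1 h)
  have hnz := mem_nonZeroDivisors_iff_ne_zero.2 h1
  obtain ⟨n, hn⟩ := ENat.ne_top_iff_exists.1 (Ring.ord_ne_top hnz)
  have h4 : Ring.ordFrac R (algebraMap R F (i x)) ≠ 1 := by
    rw [Ring.ordFrac_eq_ord R h1, Ring.ordMonoidWithZeroHom_eq_coe R hnz hn.symm]
    rw [← hn] at h3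
    intro h
    have : (n : ℤ) = 0 := by
      have h' := WithZero.coe_injective (h.trans WithZero.coe_one.symm)
      exact h'
    apply h3
    exact_mod_cast this
  have h5 : IsFractionRing.lift (K := K) hf (algebraMap C K x) = algebraMap R F (i x) :=
    IsFractionRing.lift_algebraMap hf x
  intro h6
  apply h4
  rw [← h5]
  exact h6

lemma ord_aux2 {C K R : Type*} [CommRing C] [IsDomain C] [Field K] [Algebra C K]
    [IsFractionRing C K] [CommRing R] [IsDomain R] [IsNoetherianRing R] [Ring.KrullDimLE 1 R]
    (i : C →+* R) (hinjR : Function.Injective i)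
    (x : C) (hx0 : x ≠ 0) (h2 : ¬ IsUnit (i x)) :
    ∃ v : K →*₀ ℤᵐ⁰, v (algebraMap C K x) ≠ 1 :=
  ord_aux (F := FractionRing R) i hinjR x hx0 h2

lemma exists_ord_ne_one {C K : Type*} [CommRing C] [IsDomain C] [IsNoetherianRing C] [Field K]
    [Algebra C K] [IsFractionRing C K] (x : C) (hx0 : x ≠ 0) (hx : ¬ IsUnit x) :
    ∃ v : K →*₀ ℤᵐ⁰, v (algebraMap C K x) ≠ 1 := by
  obtain ⟨m, hm, hxm⟩ := exists_max_ideal_of_mem_nonunits hx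
  have hle : Ideal.span {x} ≤ m := by simpa [Ideal.span_singleton_le_iff_mem] using hxm
  have := hm.isPrime
  obtain ⟨P, hP, hPm⟩ := Ideal.exists_minimalPrimes_le hle
  have hPp : P.IsPrime := hP.isPrime
  have hxP : x ∈ P := hP.1.2 (Ideal.mem_span_singleton_self x)
  have hht : P.height ≤ 1 :=
    Ideal.height_le_one_of_isPrincipal_of_mem_minimalPrimes (Ideal.span {x}) P hP
  have hR : IsDomain (Localization.AtPrime P) :=
    IsLocalization.isDomain_localization P.primeCompl_le_nonZeroDivisors
  have hN : IsNoetherianRing (Localization.AtPrime P) :=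
    IsLocalization.isNoetherianRing P.primeCompl _ inferInstance
  have hdim : Ring.KrullDimLE 1 (Localization.AtPrime P) := by
    rw [Ring.krullDimLE_iff, IsLocalization.AtPrime.ringKrullDim_eq_height P]
    exact_mod_cast hht
  refine ord_aux2 (R := Localization.AtPrime P) (algebraMap C _) (IsLocalization.injective _ P.primeCompl_le_nonZeroDivisors) x hx0 ?_
  rw [IsLocalization.AtPrime.isUnit_to_map_iff _ P]
  simpa [Ideal.primeCompl] using hxP

universe u1 u2 u3 in
lemma zariski_aux {C : Type u1} {A : Type u2} {K : Type u3} [CommRing C] [CommRing A] [Algebra C A]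
    [Field K] [Algebra C K] [Algebra.FiniteType C A] [Nontrivial (K ⊗[C] A)] :
    ∃ (L : Type (max u2 u3)) (_ : Field L) (_ : Algebra K L) (_ : Module.Finite K L) (φ : A →+* L),
      ∀ c : C, φ (algebraMap C A c) = algebraMap K L (algebraMap C K c) := by
  obtain ⟨n, hn⟩ := Ideal.exists_maximal (K ⊗[C] A)
  let φ : A →+* (K ⊗[C] A) ⧸ n := (Ideal.Quotient.mk n).comp
    (Algebra.TensorProduct.includeRight : A →ₐ[C] K ⊗[C] A).toRingHom
  let inst : Field ((K ⊗[C] A) ⧸ n) := Ideal.Quotient.field n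
  have hft : Algebra.FiniteType K ((K ⊗[C] A) ⧸ n) :=
    Algebra.FiniteType.of_surjective (Ideal.Quotient.mkₐ K n) (Ideal.Quotient.mkₐ_surjective _ _)
  refine ⟨(K ⊗[C] A) ⧸ n, inst, inferInstance,
    finite_of_finite_type_of_isJacobsonRing _ _, φ, fun c => ?_⟩
  have h1 := (Algebra.TensorProduct.includeRight : A →ₐ[C] K ⊗[C] A).commutes c
  have h2 : φ (algebraMap C A c) = Ideal.Quotient.mk n (algebraMap C (K ⊗[C] A) c) :=
    congrArg (Ideal.Quotient.mk n) h1
  rw [h2]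
  rfl

lemma isIntegral_of_inv_mem {A : Type*} [CommRing A] (u : Aˣ)
    (h : (u : A) ∈ Algebra.adjoin ℤ {((u⁻¹ : Aˣ) : A)}) : IsIntegral ℤ (u : A) := by
  rw [Algebra.adjoin_singleton_eq_range_aeval] at h
  obtain ⟨p, hp⟩ := h
  have hp : Polynomial.aeval ((u⁻¹ : Aˣ) : A) p = u := hp
  let : Invertible ((u⁻¹ : Aˣ) : A) := ⟨u, by simp, by simp⟩
  have key : Polynomial.eval₂ (algebraMap ℤ A) (u : A) p.reverse * ((u⁻¹ : Aˣ) : A) ^ p.natDegree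
      = u :=
    (Polynomial.eval₂_reverse_mul_pow (algebraMap ℤ A) ((u⁻¹ : Aˣ) : A) p).trans hp
  refine ⟨Polynomial.X ^ (p.natDegree + 1) - p.reverse, ?_, ?_⟩
  · apply Polynomial.monic_X_pow_sub
    refine lt_of_le_of_lt Polynomial.degree_le_natDegree ?_
    exact WithBot.coe_lt_coe.2 (Nat.lt_succ_of_le p.reverse_natDegree_le)
  · rw [Polynomial.eval₂_sub, Polynomial.eval₂_pow, Polynomial.eval₂_X, sub_eq_zero, pow_succ']
    nth_rewrite 1 [← key]
    rw [mul_assoc, ← mul_pow]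
    simp

lemma exists_place {A : Type*} [CommRing A] [Algebra.FiniteType ℤ A] (u : Aˣ)
    (hu : ¬ IsIntegral ℤ (u : A)) :
    ∃ (p : PrimeSpectrum A) (v : p.asIdeal.ResidueField →* ℤᵐ⁰),
      v (algebraMap A _ u) ≠ 1 := by
  let C := Algebra.adjoin ℤ {((u⁻¹ : Aˣ) : A)}
  let x : C := ⟨((u⁻¹ : Aˣ) : A), Algebra.self_mem_adjoin_singleton ℤ _⟩
  have hxA : algebraMap C A x = ((u⁻¹ : Aˣ) : A) := rfl
  have hN : IsNoetherianRing C :=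
    isNoetherianRing_of_fg ⟨{((u⁻¹ : Aˣ) : A)}, by simp [C]⟩
  have hx : ¬ IsUnit x := by
    rintro ⟨y, hy⟩
    apply hu
    apply isIntegral_of_inv_mem
    have h1 : (algebraMap C A x) * algebraMap C A ((y⁻¹ : Cˣ) : C) = 1 := by
      rw [← map_mul, ← hy]; simp
    have h2 : (u : A) = algebraMap C A ((y⁻¹ : Cˣ) : C) := by
      rw [hxA] at h1
      exact (Units.inv_mul_eq_one.1 h1)
    rw [h2]
    exact ((y⁻¹ : Cˣ) : C).2
  obtain ⟨m, hm, hxm⟩ := exists_max_ideal_of_mem_nonunits hx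
  have := hm.isPrime
  obtain ⟨q, hq, hqm⟩ := Ideal.exists_minimalPrimes_le (bot_le : ⊥ ≤ m)
  have hqp : q.IsPrime := hq.isPrime
  obtain ⟨Q, hQ, hQq⟩ := Ideal.exists_comap_eq_of_mem_minimalPrimes_of_injective
    (f := algebraMap C A) Subtype.val_injective q hq
  let q' : PrimeSpectrum C := ⟨q, hqp⟩
  have hnt : Nontrivial (q'.asIdeal.ResidueField ⊗[C] A) :=
    (PrimeSpectrum.nontrivial_iff_mem_rangeComap q').2 ⟨⟨Q, hQ⟩, PrimeSpectrum.ext hQq⟩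
  have hxq : x ∉ q := by
    rw [← hQq, Ideal.mem_comap, hxA]
    intro h
    exact hQ.ne_top (Ideal.eq_top_of_isUnit_mem _ h (Units.isUnit _))
  obtain ⟨v, hv⟩ := exists_ord_ne_one (K := q.ResidueField) (Ideal.Quotient.mk q x)
    (by rwa [Ne, Ideal.Quotient.eq_zero_iff_mem])
    (by
      intro h
      have := h.map (Ideal.Quotient.factor hqm)
      rw [Ideal.Quotient.factor_mk, Ideal.Quotient.eq_zero_iff_mem.2 hxm] at this
      exact not_isUnit_zero this)
  have hCA : Algebra.FiniteType C A := Algebra.FiniteType.of_restrictScalars_finiteType ℤ C A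
  have hnt' : Nontrivial (q.ResidueField ⊗[C] A) := hnt
  obtain ⟨L, _, _, hfin, φ, hφ⟩ := zariski_aux (C := C) (A := A) (K := q.ResidueField)
  have hφx : φ ((u⁻¹ : Aˣ) : A) = algebraMap q.ResidueField L (algebraMap C _ x) := hφ x
  have hker : (RingHom.ker φ).IsPrime := RingHom.ker_isPrime φ
  let p : PrimeSpectrum A := ⟨RingHom.ker φ, hker⟩
  let ψ : p.asIdeal.ResidueField →+* L := Ideal.ResidueField.lift _ φ le_rfl (by
    intro a ha
    have : φ a ≠ 0 := ha
    exact this.isUnit)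
  let V : p.asIdeal.ResidueField →* ℤᵐ⁰ :=
    ((v : q.ResidueField →* ℤᵐ⁰).comp (Algebra.norm q.ResidueField)).comp (ψ : _ →* L)
  refine ⟨p, V, ?_⟩
  have hV : V (algebraMap A _ ((u⁻¹ : Aˣ) : A)) ≠ 1 := by
    have : ψ (algebraMap A _ ((u⁻¹ : Aˣ) : A)) = φ ((u⁻¹ : Aˣ) : A) :=
      Ideal.ResidueField.lift_algebraMap _ _ _ _ _
    simp only [V, MonoidHom.comp_apply, MonoidHom.coe_coe, this, hφx, Algebra.norm_algebraMap,
      map_pow]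
    intro h
    have hpos : Module.finrank q.ResidueField L ≠ 0 := Module.finrank_pos.ne'
    exact hv ((pow_eq_one_iff.1 h).resolve_right hpos)
  intro h
  apply hV
  have : V (algebraMap A _ (u : A)) * V (algebraMap A _ ((u⁻¹ : Aˣ) : A)) = 1 := by
    rw [← map_mul, ← map_mul]; simp
  rwa [h, one_mul] at this

lemma isIntegral_of_roots {A M : Type*} [CommRing A] [Algebra.FiniteType ℤ A] [AddCommGroup M]
    [Module A M] [Module.Finite A M] (hM : Module.annihilator A M = ⊥) (u : Aˣ) (δ : ℕ)
    (hδ : δ ≠ 0)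
    (h : ∀ R : ℕ, ∃ r : ℕ, R ≤ r ∧ ∃ w : Module.End A M, ∀ m : M, (w ^ r) m = ((u : A) ^ δ) • m) :
    ∀ s : Aˣ, s = u ∨ s = u⁻¹ → IsIntegral ℤ (s : A) := by
  intro s hs
  by_contra hu
  obtain ⟨p, v, hv'⟩ := exists_place s hu
  have hv : v (algebraMap A _ u) ≠ 1 := by
    rcases hs with rfl | rfl
    · exact hv'
    · intro h1
      apply hv'
      have : v (algebraMap A _ (u : A)) * v (algebraMap A _ ((u⁻¹ : Aˣ) : A)) = 1 := by
        rw [← map_mul, ← map_mul]; simp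
      rwa [h1, one_mul] at this
  let κ := p.asIdeal.ResidueField
  have hp : p ∈ Module.support A M := by
    rw [Module.support_eq_zeroLocus, hM]; simp
  have hnt : Nontrivial (κ ⊗[A] M) :=
    (Module.mem_support_iff_nontrivial_residueField_tensorProduct p).1 hp
  let n := Module.finrank κ (κ ⊗[A] M)
  have hn : n ≠ 0 := Module.finrank_pos.ne'
  set a : ℤᵐ⁰ := v (algebraMap A _ u) with ha
  have ha0 : a ≠ 0 := ((u.isUnit.map (algebraMap A κ)).map v).ne_zero
  have key : ∀ R : ℕ, ∃ r : ℕ, R ≤ r ∧ ∃ y : ℤᵐ⁰, y ^ r = a ^ (δ * n) := by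
    intro R
    obtain ⟨r, hr, w, hw⟩ := h R
    refine ⟨r, hr, v (LinearMap.det (w.baseChange κ)), ?_⟩
    have h1 : w ^ r = ((u : A) ^ δ) • LinearMap.id := by ext m; simp [hw]
    have h2 : (w.baseChange κ) ^ r = ((algebraMap A κ u) ^ δ) • LinearMap.id := by
      rw [← LinearMap.baseChange_pow, h1, LinearMap.baseChange_smul, LinearMap.baseChange_id,
        ← map_pow, algebraMap_smul]
    rw [← map_pow, ← map_pow, h2, LinearMap.det_smul]
    simp [ha, pow_mul, n, κ]
  have key2 : ∀ R : ℕ, ∃ r : ℕ, R ≤ r ∧ ∃ y : ℤ, r * y = (δ * n : ℕ) * WithZero.log a := by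
    intro R
    obtain ⟨r, hr, y, hy⟩ := key R
    refine ⟨r, hr, WithZero.log y, ?_⟩
    have := congrArg WithZero.log hy
    simpa [WithZero.log_pow] using this
  have hla : WithZero.log a ≠ 0 := by
    intro h0
    apply hv
    rw [← WithZero.exp_log ha0, h0]; simp
  obtain ⟨r, hr, y, hy⟩ := key2 ((((δ * n : ℕ) : ℤ) * WithZero.log a).natAbs + 1)
  have hne : ((δ * n : ℕ) : ℤ) * WithZero.log a ≠ 0 :=
    mul_ne_zero (by exact_mod_cast mul_ne_zero hδ hn) hla
  have := Int.le_of_dvd (by positivity) ((dvd_abs _ _).2 (Dvd.intro _ hy))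
  rw [Int.abs_eq_natAbs] at this
  omega

lemma finiteType_aux {B A : Type*} [CommRing B] [CommRing A] {a : Algebra ℤ B}
    (hB : Algebra.FiniteType ℤ B) (f : B →+* A) (hf : Function.Surjective f) :
    Algebra.FiniteType ℤ A := by
  obtain rfl : a = Ring.toIntAlgebra B := Subsingleton.elim _ _
  exact Algebra.FiniteType.of_surjective (RingHom.toIntAlgHom f) hf

theorem laurent_module_int_finite (b : ℕ) (M : Type*) [AddCommGroup M]
    [Module (AddMonoidAlgebra ℤ (Fin b → ℤ)) M]
    [Module.Finite (AddMonoidAlgebra ℤ (Fin b → ℤ)) M]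
    (δ : ℕ) (hδ : δ ≠ 0)
    (h : ∀ j : Fin b, ∀ R : ℕ, ∃ r : ℕ, R ≤ r ∧
      ∃ w : Module.End (AddMonoidAlgebra ℤ (Fin b → ℤ)) M,
        ∀ m : M, (w ^ r) m =
          ((AddMonoidAlgebra.single ((Pi.single j 1 : Fin b → ℤ)) (1 : ℤ)) ^ δ) • m) :
    Module.Finite ℤ M := by
  let B := AddMonoidAlgebra ℤ (Fin b → ℤ)
  let I := Module.annihilator B M
  let A := B ⧸ I
  let instA : Algebra ℤ A := Ring.toIntAlgebra A
  let : Module A M := Module.quotientAnnihilator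
  have hsm : ∀ (c : B) (m : M), (Ideal.Quotient.mk I c : A) • m = c • m := fun _ _ => rfl
  have : IsScalarTower B A M := ⟨fun c a m => by
    obtain ⟨a, rfl⟩ := Ideal.Quotient.mk_surjective a
    change (Ideal.Quotient.mk I (c * a) : A) • m = _
    rw [hsm, hsm, mul_smul]⟩
  have : Module.Finite A M := Module.Finite.of_restrictScalars_finite B A M
  have hann : Module.annihilator A M = ⊥ := by
    rw [eq_bot_iff]
    intro a ha
    obtain ⟨a, rfl⟩ := Ideal.Quotient.mk_surjective a
    rw [Module.mem_annihilator] at ha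
    exact Ideal.Quotient.eq_zero_iff_mem.2 (Module.mem_annihilator.2 ha)
  have hBft : Algebra.FiniteType ℤ B := inferInstance
  have : Algebra.FiniteType ℤ A :=
    finiteType_aux hBft (Ideal.Quotient.mk I : B →+* A)
      Ideal.Quotient.mk_surjective
  let g : Multiplicative (Fin b → ℤ) →* A :=
    ((Ideal.Quotient.mk I : B →+* A) : B →* A).comp (AddMonoidAlgebra.of ℤ (Fin b → ℤ))
  let U : Multiplicative (Fin b → ℤ) →* Aˣ := g.toHomUnits
  have hU : ∀ x, (U x : A) = Ideal.Quotient.mk I (AddMonoidAlgebra.single x.toAdd 1) :=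
    fun x => rfl
  have hint : ∀ j : Fin b, ∀ s : Aˣ,
      (s = U (.ofAdd (Pi.single j 1)) ∨ s = (U (.ofAdd (Pi.single j 1)))⁻¹) →
      IsIntegral ℤ (s : A) := by
    intro j
    refine isIntegral_of_roots hann (U (.ofAdd (Pi.single j 1))) δ hδ fun R => ?_
    obtain ⟨r, hr, w, hw⟩ := h j R
    let w' : Module.End A M :=
      { toFun := w
        map_add' := w.map_add
        map_smul' := fun a m => by
          obtain ⟨a, rfl⟩ := Ideal.Quotient.mk_surjective a
          exact w.map_smul a m }
    have hpow : ∀ (k : ℕ) (m : M), (w' ^ k) m = (w ^ k) m := by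
      intro k
      induction k with
      | zero => intro m; rfl
      | succ k ih =>
        intro m
        rw [pow_succ, pow_succ, Module.End.mul_apply, Module.End.mul_apply, ih]
        rfl
    refine ⟨r, hr, w', fun m => ?_⟩
    rw [hpow, hw, hU, ← map_pow, hsm]
    rfl
  have hz : ∀ (j : Fin b) (n : ℤ), IsIntegral ℤ (U (.ofAdd (Pi.single j n)) : A) := by
    intro j n
    have h1 : (Multiplicative.ofAdd (Pi.single j n : Fin b → ℤ)) =
        (Multiplicative.ofAdd (Pi.single j 1 : Fin b → ℤ)) ^ n := by
      rw [← ofAdd_zsmul, ← Pi.single_smul]; simp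
    rw [h1, map_zpow]
    obtain ⟨k, rfl | rfl⟩ := n.eq_nat_or_neg
    · rw [zpow_natCast, Units.val_pow_eq_pow_val]
      exact (hint j _ (Or.inl rfl)).pow k
    · rw [zpow_neg, zpow_natCast, ← inv_pow, Units.val_pow_eq_pow_val]
      exact (hint j _ (Or.inr rfl)).pow k
  have hall : ∀ x : Fin b → ℤ, IsIntegral ℤ (U (.ofAdd x) : A) := by
    intro x
    rw [← Finset.univ_sum_single x, ofAdd_sum, map_prod, Units.coe_prod]
    exact IsIntegral.prod _ fun j _ => hz j (x j)
  have hAint : Algebra.IsIntegral ℤ A := by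
    refine ⟨fun a => ?_⟩
    obtain ⟨a, rfl⟩ := Ideal.Quotient.mk_surjective a
    induction a using AddMonoidAlgebra.induction_on with
    | of x => exact hall x
    | add f g hf hg => rw [map_add]; exact hf.add hg
    | smul c f hf =>
      have : (Ideal.Quotient.mk I (c • f) : A) = c • (Ideal.Quotient.mk I f : A) :=
        map_zsmul (Ideal.Quotient.mk I) c f
      rw [this]
      exact hf.smul c
  have hAfin : Module.Finite ℤ A := Algebra.IsIntegral.finite
  exact Module.Finite.trans A M
end
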